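/- arXiv:2104.10023 — 3 statements merged into one kernel-verified Lean document; each statement's English description precedes it below -/
import Mathlib

section
/- There exists an absolute constant K > 0 such that for every odd prime p and every a ∈ F_p with a ≠ 0, one has |Σ_{b=1}^{p-1} Σ_{c=1}^{p-1} ((b²−a²c²)/p)·((b²−1)/p)·((c²−1)/p)| ≤ K·p. -/
section Stepanov
open Polynomial

noncomputable def stP {F : Type} [Field F] (f : F[X]) (e : ℕ) : ℕ → (F[X] →ₗ[F] F[X])
  | 0 => LinearMap.id
  | k + 1 => ((e - k : ℕ) : F) • (LinearMap.mulLeft F (derivative f)) ∘ₗ stP f e k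
      + (LinearMap.mulLeft F f) ∘ₗ derivative ∘ₗ stP f e k

lemma stP_succ {F : Type} [Field F] (f : F[X]) (e k : ℕ) (s : F[X]) :
    stP f e (k+1) s = C ((e - k : ℕ) : F) * (derivative f * stP f e k s)
      + f * derivative (stP f e k s) := by
  simp [stP, smul_eq_C_mul]

lemma stP_deriv {F : Type} [Field F] (f : F[X]) (e k : ℕ) (hk : k ≤ e) (s : F[X]) :
    derivative^[k] (f ^ e * s) = f ^ (e - k) * stP f e k s := by
  induction k with
  | zero => simp [stP]
  | succ k ih =>
    rw [Function.iterate_succ_apply', ih (by omega), stP_succ]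
    obtain ⟨d, hd⟩ : ∃ d, e - k = d + 1 := ⟨e - k - 1, by omega⟩
    have : e - (k+1) = d := by omega
    rw [this, hd, derivative_mul, derivative_pow]
    simp only [Nat.add_sub_cancel, pow_succ]
    ring

lemma stP_mul {F : Type} [Field F] (f : F[X]) (e k : ℕ) (s h : F[X]) (hh : derivative h = 0) :
    stP f e k (s * h) = stP f e k s * h := by
  induction k with
  | zero => simp [stP]
  | succ k ih =>
    rw [stP_succ, stP_succ, ih, derivative_mul, hh]; ring

lemma stP_deg {F : Type} [Field F] (f : F[X]) (hf : f.natDegree = 3) (e k B : ℕ) (s : F[X])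
    (hs : s.degree < B) : (stP f e k s).degree < ((B + 2 * k : ℕ) : WithBot ℕ) := by
  induction k with
  | zero => simpa [stP] using hs
  | succ k ih =>
    rw [stP_succ]
    set u := stP f e k s with hu
    by_cases h0 : u = 0
    · simp [h0]; exact WithBot.bot_lt_coe _
    have hu' : u.natDegree < B + 2 * k := by
      rwa [natDegree_lt_iff_degree_lt h0]
    have hd : (derivative f).natDegree ≤ 2 := by
      have := natDegree_derivative_le f; omega
    have hle : (C ((e - k : ℕ) : F) * (derivative f * u) + f * derivative u).natDegree
        ≤ u.natDegree + 2 := by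
      refine (natDegree_add_le _ _).trans (max_le ?_ ?_)
      · refine (natDegree_C_mul_le _ _).trans (natDegree_mul_le.trans (by omega))
      · by_cases h1 : derivative u = 0
        · simp [h1]
        have h2 : u.natDegree ≠ 0 := by
          intro h; exact h1 (by rw [eq_C_of_natDegree_eq_zero h]; simp)
        refine natDegree_mul_le.trans ?_
        have := natDegree_derivative_le u
        omega
    refine degree_le_natDegree.trans_lt ?_
    exact_mod_cast (by omega : _ < B + 2 * (k+1))

lemma st_indep {p : ℕ} [Fact p.Prime] (f : (ZMod p)[X]) (hf : f.natDegree = 3)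
    (h0 : f.eval 0 ≠ 0) (hp : p ≠ 2) (B : ℕ) (hB : 2 * B + 1 < p) (J : ℕ)
    (r s : Fin J → (ZMod p)[X]) (hr : ∀ j, (r j).degree < B) (hs : ∀ j, (s j).degree < B)
    (h : ∑ j : Fin J, (r j + f ^ ((p-1)/2) * s j) * X ^ ((j : ℕ) * p) = 0) :
    ∀ j, r j = 0 ∧ s j = 0 := by
  have hpp : p.Prime := Fact.out
  induction J with
  | zero => intro j; exact j.elim0
  | succ J ih =>
    rw [Fin.sum_univ_succ] at h
    have e1 : ∑ j : Fin J, (r j.succ + f ^ ((p-1)/2) * s j.succ) * X ^ (((j.succ : Fin (J+1)) : ℕ) * p)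
       = X ^ p * ∑ j : Fin J, (r j.succ + f ^ ((p-1)/2) * s j.succ) * X ^ ((j : ℕ) * p) := by
      rw [Finset.mul_sum]
      refine Finset.sum_congr rfl fun j _ => ?_
      simp only [Fin.val_succ, add_mul, one_mul, pow_add]; ring
    rw [e1] at h
    simp only [Fin.val_zero, zero_mul, pow_zero, mul_one] at h
    have hdvd : X ^ p ∣ r 0 + f ^ ((p-1)/2) * s 0 := by
      rw [eq_neg_of_add_eq_zero_left h]
      exact (dvd_mul_right _ _).neg_right
    have hfp : X ^ p ∣ f ^ p - C (f.eval 0) := by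
      have : f ^ p - C (f.eval 0) = (f - C (f.eval 0)) ^ p := by
        rw [sub_pow_expChar, ← C_pow, ZMod.pow_card]
      rw [this]
      apply pow_dvd_pow_of_dvd
      have := X_sub_C_dvd_sub_C_eval (p := f) (a := 0)
      simpa using this
    have hdvd2 : X ^ p ∣ f * (r 0)^2 - C (f.eval 0) * (s 0)^2 := by
      have e2 : f * (r 0)^2 - C (f.eval 0) * (s 0)^2
        = (r 0 + f ^ ((p-1)/2) * s 0) * (f * (r 0 - f ^ ((p-1)/2) * s 0))
          + (f ^ p - C (f.eval 0)) * (s 0)^2 := by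
        have : f ^ p = f * f ^ ((p-1)/2) * f ^ ((p-1)/2) := by
          rw [mul_assoc, ← pow_add, ← pow_succ']
          congr 1
          have := hpp.eq_two_or_odd; omega
        rw [this]; ring
      rw [e2]
      exact dvd_add (hdvd.mul_right _) (hfp.mul_right _)
    have hdeg : (f * (r 0)^2 - C (f.eval 0) * (s 0)^2).degree < p := by
      have key : ∀ u : (ZMod p)[X], u.degree < B → u = 0 ∨ u.natDegree < B := by
        intro u hu
        by_cases h : u = 0
        · exact Or.inl h
        · right; rwa [natDegree_lt_iff_degree_lt h]
      refine (degree_sub_le _ _).trans_lt (max_lt ?_ ?_)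
      · rcases key _ (hr 0) with h | h
        · simp [h]
        · refine degree_le_natDegree.trans_lt ?_
          have : (f * (r 0)^2).natDegree ≤ 3 + 2 * (r 0).natDegree := by
            refine natDegree_mul_le.trans ?_
            have := natDegree_pow_le (p := r 0) (n := 2)
            omega
          exact_mod_cast (by omega : _ < p)
      · rcases key _ (hs 0) with h | h
        · simp [h]
        · refine degree_le_natDegree.trans_lt ?_
          have : (C (f.eval 0) * (s 0)^2).natDegree ≤ 2 * (s 0).natDegree := by
            refine (natDegree_C_mul_le _ _).trans ?_
            exact natDegree_pow_le (p := s 0) (n := 2)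
          exact_mod_cast (by omega : _ < p)
    have hz : f * (r 0)^2 - C (f.eval 0) * (s 0)^2 = 0 := by
      apply eq_zero_of_dvd_of_degree_lt hdvd2
      simpa using hdeg
    have hf0 : f ≠ 0 := by rintro rfl; simp at hf
    have hs0 : s 0 = 0 := by
      by_contra hs0
      have heq := sub_eq_zero.mp hz
      have hr0 : r 0 ≠ 0 := by
        intro hr0
        rw [hr0] at heq
        have := mul_ne_zero (C_ne_zero.mpr h0) (pow_ne_zero 2 hs0)
        apply this; rw [← heq]; simp
      have := congrArg natDegree heq
      rw [natDegree_mul hf0 (pow_ne_zero 2 hr0), natDegree_C_mul h0, natDegree_pow, natDegree_pow, hf] at this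
      omega
    have hr0 : r 0 = 0 := by
      rw [hs0] at hz
      simpa [hf0] using hz
    have hrest : ∑ j : Fin J, (r j.succ + f ^ ((p-1)/2) * s j.succ) * X ^ ((j : ℕ) * p) = 0 := by
      rw [hr0, hs0] at h
      simpa using h
    have := ih (fun j => r j.succ) (fun j => s j.succ) (fun j => hr _) (fun j => hs _) hrest
    intro j
    refine Fin.cases ⟨hr0, hs0⟩ this j

end Stepanov

section Stepanov2
open Polynomial

lemma st_card {p : ℕ} [Fact p.Prime] (f : (ZMod p)[X]) (hf : f.natDegree = 3)
    (h0 : f.eval 0 ≠ 0) (hp : p ≠ 2) (B J l : ℕ) (hB : 2 * B + 1 < p) (hl : l ≤ p)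
    (hcount : l * (B + 2 * l + J) < 2 * (J * B)) (ε : ZMod p) (S : Finset (ZMod p))
    (hS : ∀ a ∈ S, (f.eval a) ^ ((p-1)/2) = ε) :
    l * S.card ≤ 3 * l + B + 3 * ((p-1)/2) + J * p := by
  have hpp : p.Prime := Fact.out
  set g := (p-1)/2 with hg
  set M := B + 2 * l + J with hM
  let V := (Fin J → degreeLT (ZMod p) B) × (Fin J → degreeLT (ZMod p) B)
  let Φ : Fin l → V →ₗ[ZMod p] (ZMod p)[X] := fun k =>
    ∑ j : Fin J, (LinearMap.mulRight (ZMod p) ((X : (ZMod p)[X]) ^ (j : ℕ))) ∘ₗ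
      ((stP f l k) ∘ₗ (Submodule.subtype _) ∘ₗ (LinearMap.proj j) ∘ₗ (LinearMap.fst _ _ _)
      + ε • (stP f (l+g) k) ∘ₗ (Submodule.subtype _) ∘ₗ (LinearMap.proj j) ∘ₗ (LinearMap.snd _ _ _))
  have hΦ : ∀ k v, Φ k v = ∑ j : Fin J, (stP f l k (v.1 j) + C ε * stP f (l+g) k (v.2 j)) * X ^ (j : ℕ) := by
    intro k v
    simp [Φ, smul_eq_C_mul]
    rfl
  let Ψ : V →ₗ[ZMod p] (Fin l → Fin M → ZMod p) :=
    LinearMap.pi fun k => LinearMap.pi fun i => (lcoeff (ZMod p) (i : ℕ)) ∘ₗ Φ k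
  have : FiniteDimensional (ZMod p) (degreeLT (ZMod p) B) :=
    (degreeLTEquiv (ZMod p) B).symm.finiteDimensional
  have hfr : Module.finrank (ZMod p) (degreeLT (ZMod p) B) = B := by
    rw [(degreeLTEquiv (ZMod p) B).finrank_eq]; simp
  have hker : LinearMap.ker Ψ ≠ ⊥ := by
    apply LinearMap.ker_ne_bot_of_finrank_lt
    simp only [V, Module.finrank_prod, Module.finrank_pi_fintype, hfr]
    simp
    nlinarith
  obtain ⟨v, hv, hv0⟩ := (Submodule.ne_bot_iff _).mp hker
  have hd1 : ∀ j, ((v.1 j : (ZMod p)[X])).degree < B := fun j => mem_degreeLT.mp (v.1 j).2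
  have hd2 : ∀ j, ((v.2 j : (ZMod p)[X])).degree < B := fun j => mem_degreeLT.mp (v.2 j).2
  have hz : ∀ k, Φ k v = 0 := by
    intro k
    ext i
    by_cases hi : i < M
    · have := congrFun (congrFun (LinearMap.mem_ker.mp hv) k) ⟨i, hi⟩
      simpa [Ψ] using this
    · rw [coeff_zero]
      apply coeff_eq_zero_of_degree_lt
      refine lt_of_lt_of_le (b := ((M : ℕ) : WithBot ℕ)) ?_ (by exact_mod_cast not_lt.mp hi)
      rw [← mem_degreeLT, hΦ]
      refine Submodule.sum_mem _ fun j _ => ?_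
      rw [mem_degreeLT]
      set u := (stP f l k (v.1 j) + C ε * stP f (l+g) k (v.2 j)) with hu
      have hudeg : u.degree < ((B + 2 * k : ℕ) : WithBot ℕ) := by
        refine (degree_add_le _ _).trans_lt (max_lt (stP_deg f hf _ _ _ _ (hd1 j)) ?_)
        refine lt_of_le_of_lt ?_ (stP_deg f hf (l+g) k _ _ (hd2 j))
        rw [← smul_eq_C_mul]
        exact degree_smul_le _ _
      by_cases hu0 : u = 0
      · rw [hu0]; simp
      · have := (natDegree_lt_iff_degree_lt hu0).mpr hudeg
        rw [← natDegree_lt_iff_degree_lt (mul_ne_zero hu0 (pow_ne_zero _ X_ne_zero)),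
          natDegree_mul_X_pow _ hu0]
        have := k.2; have := j.2
        omega
  let R0 : (ZMod p)[X] := ∑ j : Fin J, ((v.1 j : (ZMod p)[X]) + f ^ g * (v.2 j : (ZMod p)[X])) * X ^ ((j : ℕ) * p)
  have hR0 : R0 ≠ 0 := by
    intro h
    have := st_indep f hf h0 hp B hB J (fun j => v.1 j) (fun j => v.2 j) hd1 hd2 h
    apply hv0
    ext j
    · simp [(this j).1]
    · simp [(this j).2]
  have hf0 : f ≠ 0 := by rintro rfl; simp at hf
  let R := f ^ l * R0
  have hR : R ≠ 0 := mul_ne_zero (pow_ne_zero _ hf0) hR0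
  have hdX : ∀ j : ℕ, derivative ((X : (ZMod p)[X]) ^ (j * p)) = 0 := by
    intro j; rw [derivative_X_pow]; simp
  have hRe : R = ∑ j : Fin J, (f ^ l * ((v.1 j : (ZMod p)[X]) * X ^ ((j : ℕ) * p))
      + f ^ (l + g) * ((v.2 j : (ZMod p)[X]) * X ^ ((j : ℕ) * p))) := by
    simp only [R, R0, Finset.mul_sum]
    refine Finset.sum_congr rfl fun j _ => ?_
    rw [pow_add]; ring
  have hroot : ∀ a ∈ S, ∀ k < l, (derivative^[k] R).IsRoot a := by
    intro a ha k hk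
    have h1 : derivative^[k] R = ∑ j : Fin J, (f ^ (l-k) * (stP f l k (v.1 j) * X ^ ((j : ℕ) * p))
      + f ^ (l + g - k) * (stP f (l+g) k (v.2 j) * X ^ ((j : ℕ) * p))) := by
      rw [hRe, iterate_derivative_sum]
      refine Finset.sum_congr rfl fun j _ => ?_
      rw [iterate_map_add derivative, stP_deriv f l k hk.le, stP_deriv f (l+g) k (by omega),
        stP_mul _ _ _ _ _ (hdX j), stP_mul _ _ _ _ _ (hdX j)]
    have h2 := congrArg (eval a) (hz ⟨k, hk⟩)
    rw [hΦ, eval_finsetSum, eval_zero] at h2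
    rw [IsRoot, h1, eval_finsetSum]
    rw [← mul_zero (eval a f ^ (l-k)), ← h2, Finset.mul_sum]
    refine Finset.sum_congr rfl fun j _ => ?_
    have h3 : l + g - k = (l - k) + g := by omega
    have h4 : a ^ ((j : ℕ) * p) = a ^ (j : ℕ) := by rw [pow_mul, ZMod.pow_card]
    simp only [eval_add, eval_mul, eval_pow, eval_X, eval_C, h3, pow_add, h4, hS a ha]
    ring
  have hdvd : ∏ a ∈ S, (X - C a) ^ l ∣ R := by
    apply Finset.prod_dvd_of_coprime
    · intro a _ b _ hab
      exact IsCoprime.pow (isCoprime_X_sub_C_of_isUnit_sub (sub_ne_zero.mpr hab).isUnit)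
    · intro a ha
      rw [← le_rootMultiplicity_iff hR]
      rcases Nat.eq_zero_or_pos l with h | h
      · omega
      have := lt_rootMultiplicity_of_isRoot_iterate_derivative_of_mem_nonZeroDivisors' (n := l - 1) hR
        (t := a) (fun m hm => hroot a ha m (by omega)) (by
          intro m hm hm0
          rw [mem_nonZeroDivisors_iff_ne_zero, Ne, ZMod.natCast_eq_zero_iff]
          intro h; have := Nat.le_of_dvd (by omega) h; omega)
      omega
  have hdeg := natDegree_le_of_dvd hdvd hR
  have e1 : (∏ a ∈ S, (X - C a) ^ l).natDegree = l * S.card := by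
    rw [natDegree_prod _ _ (fun a _ => pow_ne_zero _ (X_sub_C_ne_zero a))]
    simp [mul_comm]
  rw [e1] at hdeg
  refine hdeg.trans ?_
  refine natDegree_mul_le.trans ?_
  have e2 : R0.natDegree ≤ B + 3 * g + J * p := by
    refine natDegree_sum_le_of_forall_le _ _ fun j _ => ?_
    refine natDegree_mul_le.trans ?_
    have a1 : ∀ u : (ZMod p)[X], u.degree < B → u.natDegree ≤ B := fun u hu =>
      natDegree_le_of_degree_le hu.le
    have a2 : ((v.1 j : (ZMod p)[X]) + f ^ g * (v.2 j : (ZMod p)[X])).natDegree ≤ B + 3 * g := by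
      refine (natDegree_add_le _ _).trans (max_le ?_ ?_)
      · have := a1 _ (hd1 j); omega
      · refine natDegree_mul_le.trans ?_
        have := a1 _ (hd2 j)
        rw [natDegree_pow, hf]; omega
    rw [natDegree_X_pow]
    have : (j : ℕ) * p ≤ J * p := Nat.mul_le_mul_right _ j.2.le
    omega
  rw [natDegree_pow, hf]
  omega

lemma st_card2 {p : ℕ} [Fact p.Prime] (f : (ZMod p)[X]) (hf : f.natDegree = 3)
    (h0 : f.eval 0 ≠ 0) (hp : 100 ≤ p) (ε : ZMod p) (S : Finset (ZMod p))
    (hS : ∀ a ∈ S, (f.eval a) ^ ((p-1)/2) = ε) :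
    2 * S.card ≤ p + 100 * p.sqrt := by
  have hpp : p.Prime := Fact.out
  have hodd : p % 2 = 1 := by have := hpp.eq_two_or_odd; omega
  set n := p.sqrt with hn
  have hn1 : n * n ≤ p := Nat.sqrt_le p
  have hn2 : p < (n+1) * (n+1) := Nat.lt_succ_sqrt p
  have hn3 : 10 ≤ n := by
    rw [hn, Nat.le_sqrt]; omega
  obtain ⟨m, hm⟩ : ∃ m, p = 2 * m + 3 := ⟨(p-3)/2, by omega⟩
  have := st_card f hf h0 (by omega) m (n+20) (2*n) (by omega) (by nlinarith) (by nlinarith) ε S hS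
  have h3 : (p-1)/2 = m + 1 := by omega
  rw [h3] at this
  have h4 : 2 * n * S.card ≤ n * (p + 100 * n) := by nlinarith
  have h5 : n * (2 * S.card) ≤ n * (p + 100 * n) := by linarith
  exact Nat.le_of_mul_le_mul_left h5 (by omega)

lemma st_sum {p : ℕ} [Fact p.Prime] (f : (ZMod p)[X]) (hf : f.natDegree = 3)
    (hp : 100 ≤ p) :
    (∑ x : ZMod p, quadraticChar (ZMod p) (f.eval x)) ^ 2 ≤ 40000 * p := by
  classical
  have hpp : p.Prime := Fact.out
  have hchar : ringChar (ZMod p) ≠ 2 := by rw [ZMod.ringChar_zmod_n]; omega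
  have hf0 : f ≠ 0 := by rintro rfl; simp at hf
  have hrt : (Finset.univ.filter fun x => f.eval x = 0).card ≤ 3 := by
    have : (Finset.univ.filter fun x => f.eval x = 0) ⊆ f.roots.toFinset := by
      intro x hx; simp at hx; simp [hf0, hx]
    refine (Finset.card_le_card this).trans ((Multiset.toFinset_card_le _).trans ?_)
    rw [← hf]; exact card_roots' f
  obtain ⟨x0, hx0⟩ : ∃ x0, f.eval x0 ≠ 0 := by
    by_contra! h
    rw [Finset.filter_true_of_mem (fun x _ => h x), Finset.card_univ, ZMod.card] at hrt
    omega
  set F := f.comp (X + C x0) with hF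
  have hFd : F.natDegree = 3 := by rw [hF, natDegree_comp, hf]; simp
  have hF0 : F.eval 0 ≠ 0 := by simpa [hF] using hx0
  have hsum : ∑ x : ZMod p, quadraticChar (ZMod p) (f.eval x) = ∑ x : ZMod p, quadraticChar (ZMod p) (F.eval x) := by
    rw [← Equiv.sum_comp (Equiv.addRight x0)]
    simp [hF]
  have hF00 : F ≠ 0 := by intro h; rw [h] at hFd; simp at hFd
  have hrtF : (Finset.univ.filter fun x => F.eval x = 0).card ≤ 3 := by
    have : (Finset.univ.filter fun x => F.eval x = 0) ⊆ F.roots.toFinset := by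
      intro x hx; simp at hx; simp [hF00, hx]
    refine (Finset.card_le_card this).trans ((Multiset.toFinset_card_le _).trans ?_)
    rw [← hFd]; exact card_roots' F
  have hpow : ∀ x, ((quadraticChar (ZMod p) (F.eval x) : ℤ) : ZMod p) = (F.eval x) ^ ((p-1)/2) := by
    intro x
    rw [quadraticChar_eq_pow_of_char_ne_two' hchar, ZMod.card]
    congr 1
    have := hpp.eq_two_or_odd; omega
  set S1 := Finset.univ.filter fun x => quadraticChar (ZMod p) (F.eval x) = 1 with hS1
  set S2 := Finset.univ.filter fun x => quadraticChar (ZMod p) (F.eval x) = -1 with hS2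
  set S0 := Finset.univ.filter fun x => F.eval x = 0 with hS0
  have c1 := st_card2 F hFd hF0 hp 1 S1 (by
    intro a ha; rw [← hpow, (Finset.mem_filter.mp ha).2]; simp)
  have c2 := st_card2 F hFd hF0 hp (-1) S2 (by
    intro a ha; rw [← hpow, (Finset.mem_filter.mp ha).2]; simp)
  have hq : ∀ x, quadraticChar (ZMod p) (F.eval x) =
     (if quadraticChar (ZMod p) (F.eval x) = 1 then (1:ℤ) else 0) - (if quadraticChar (ZMod p) (F.eval x) = -1 then 1 else 0) := by
    intro x
    by_cases h : F.eval x = 0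
    · simp [h]
    · rcases quadraticChar_dichotomy h with h | h <;> simp [h]
  have hq1 : ∀ x, (1:ℤ) =
     (if quadraticChar (ZMod p) (F.eval x) = 1 then (1:ℤ) else 0) + (if quadraticChar (ZMod p) (F.eval x) = -1 then 1 else 0)
      + (if F.eval x = 0 then 1 else 0) := by
    intro x
    by_cases h : F.eval x = 0
    · simp [h]
    · rcases quadraticChar_dichotomy h with h' | h' <;> simp [h, h']
  have s1 : ∑ x : ZMod p, quadraticChar (ZMod p) (F.eval x) = (S1.card : ℤ) - S2.card := by
    rw [Finset.sum_congr rfl fun x _ => hq x, Finset.sum_sub_distrib, hS1, hS2]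
    simp
  have s2 : (p : ℤ) = S1.card + S2.card + S0.card := by
    have : (p : ℤ) = ∑ x : ZMod p, (1:ℤ) := by simp
    rw [this, Finset.sum_congr rfl fun x _ => hq1 x, Finset.sum_add_distrib, Finset.sum_add_distrib, hS1, hS2, hS0]
    simp
  rw [hsum, s1]
  have hn1 : p.sqrt * p.sqrt ≤ p := Nat.sqrt_le p
  have hn3 : 10 ≤ p.sqrt := by
    rw [Nat.le_sqrt]; omega
  set n := p.sqrt
  have b1 : (S1.card : ℤ) - S2.card ≤ 200 * n := by zify at *; linarith
  have b2 : -(200 * n : ℤ) ≤ (S1.card : ℤ) - S2.card := by zify at *; linarith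
  have := abs_le.mpr ⟨b2, b1⟩
  have h6 := sq_le_sq' b2 b1
  have hn1' : (n : ℤ) * n ≤ p := by exact_mod_cast hn1
  nlinarith

end Stepanov2

section CharSums
set_option linter.unusedSectionVars false
variable {F : Type} [Field F] [Fintype F] [DecidableEq F]

local notation "χ" => quadraticChar F

lemma cs_affine (g : F → ℤ) (α β : F) (hα : α ≠ 0) : ∑ x, g (α * x + β) = ∑ x, g x := by
  rw [← Equiv.sum_comp ((Equiv.mulLeft₀ α hα).trans (Equiv.addRight β)) g]
  rfl

lemma cs_push {ι : Type} [Fintype ι] (φ : ι → F) (g : F → ℤ) :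
    ∑ x, g (φ x) = ∑ n, (∑ x, if φ x = n then (1:ℤ) else 0) * g n := by
  simp only [Finset.sum_mul]
  rw [Finset.sum_comm]
  refine Finset.sum_congr rfl fun x _ => ?_
  simp

lemma cs_two (hF : ringChar F ≠ 2) : (2 : F) ≠ 0 := Ring.two_ne_zero hF

lemma cs_sqrt (hF : ringChar F ≠ 2) (D : F) : (∑ x : F, if x ^ 2 = D then (1:ℤ) else 0) = 1 + χ D := by
  have := quadraticChar_card_sqrts hF D
  rw [add_comm, ← this]
  simp

lemma cs_count (hF : ringChar F ≠ 2) (A B C : F) (hA : A ≠ 0) :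
    (∑ x : F, if A * x ^ 2 + B * x + C = 0 then (1:ℤ) else 0) = 1 + χ (B ^ 2 - 4 * A * C) := by
  have h2 := cs_two hF
  rw [← cs_sqrt hF, ← cs_affine (fun y => if y ^ 2 = B ^ 2 - 4 * A * C then (1:ℤ) else 0) (2 * A) B (mul_ne_zero h2 hA)]
  refine Finset.sum_congr rfl fun x _ => ?_
  congr 1
  rw [eq_iff_iff, ← sub_eq_zero (a := (2 * A * x + B) ^ 2)]
  have : (2 * A * x + B) ^ 2 - (B ^ 2 - 4 * A * C) = (2 * 2 * A) * (A * x ^ 2 + B * x + C) := by ring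
  rw [this]; simp [h2, hA]

lemma cs_abs (x : F) : |χ x| ≤ 1 := by
  by_cases h : x = 0
  · simp [h]
  · rcases quadraticChar_dichotomy h with h | h <;> simp [h]

lemma cs_mulself (x : F) (hx : x ≠ 0) : χ x * χ x = 1 := by
  have := quadraticChar_sq_one hx
  rw [← sq, this]

lemma cs_sum0 (hF : ringChar F ≠ 2) (α β : F) (hα : α ≠ 0) : ∑ x, χ (α * x + β) = 0 := by
  rw [cs_affine (fun x => χ x) α β hα]; exact quadraticChar_sum_zero hF

lemma cs_abs_sum {ι : Type} [Fintype ι] (g : ι → ℤ) (h : ∀ x, |g x| ≤ 1) : |∑ x, g x| ≤ Fintype.card ι := by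
  refine (Finset.abs_sum_le_sum_abs _ _).trans ((Finset.sum_le_sum fun x _ => h x).trans ?_)
  simp

lemma cs_jac (hF : ringChar F ≠ 2) (D : F) (hD : D ≠ 0) : ∑ u, χ u * χ (u - D) = -1 := by
  have h := jacobiSum_nontrivial_inv (quadraticChar_ne_one hF)
  rw [(quadraticChar_isQuadratic F).inv] at h
  rw [← cs_affine (fun u => χ u * χ (u - D)) D 0 hD]
  have : ∀ x, χ (D * x + 0) * χ (D * x + 0 - D) = χ (-1) * (χ x * χ (1 - x)) := by
    intro x
    have e : D * x + 0 - D = D * ((-1) * (1 - x)) := by ring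
    rw [e, add_zero, map_mul, map_mul, map_mul]
    linear_combination (χ x * χ (-1) * χ (1-x)) * cs_mulself D hD
  rw [Finset.sum_congr rfl fun x _ => this x, ← Finset.mul_sum]
  rw [jacobiSum] at h
  rw [h]
  linear_combination - cs_mulself (-1 : F) (by simp)

lemma cs_sqsum (hF : ringChar F ≠ 2) (g : F → ℤ) : ∑ x, g (x ^ 2) = ∑ u, (1 + χ u) * g u := by
  rw [cs_push (fun x : F => x ^ 2) g]
  refine Finset.sum_congr rfl fun u _ => ?_
  rw [cs_sqrt hF]

lemma cs_quad (hF : ringChar F ≠ 2) (A B C : F) (hA : A ≠ 0) (hD : B ^ 2 - 4 * A * C ≠ 0) :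
    ∑ x, χ (A * x ^ 2 + B * x + C) = - χ A := by
  have h2 := cs_two hF
  set D := B ^ 2 - 4 * A * C with hDd
  have e : ∀ x, χ (A * x ^ 2 + B * x + C) = χ A * χ ((2 * A * x + B) ^ 2 - D) := by
    intro x
    have : (2 * A * x + B) ^ 2 - D = A * (2 * (2 * (A * x ^ 2 + B * x + C))) := by rw [hDd]; ring
    rw [this, map_mul, map_mul, map_mul]
    linear_combination -(χ (A * x ^ 2 + B * x + C)) * (cs_mulself A hA * χ 2 * χ 2) - (χ (A * x ^ 2 + B * x + C)) * cs_mulself (2:F) h2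
  rw [Finset.sum_congr rfl fun x _ => e x, ← Finset.mul_sum,
    cs_affine (fun y => χ (y^2 - D)) (2*A) B (mul_ne_zero h2 hA), cs_sqsum hF (fun u => χ (u - D))]
  simp only [add_mul, one_mul, Finset.sum_add_distrib]
  have := cs_sum0 hF 1 (-D) one_ne_zero
  simp only [one_mul, ← sub_eq_add_neg] at this
  rw [this, cs_jac hF D hD]; ring

lemma cs_quad_le (hF : ringChar F ≠ 2) (A B C : F) (hA : A ≠ 0) (hD : B ^ 2 - 4 * A * C ≠ 0) :
    |∑ x, χ (A * x ^ 2 + B * x + C)| ≤ 1 := by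
  rw [cs_quad hF A B C hA hD, abs_neg]; exact cs_abs _

/-- sum over a family bounded by 1 except at one point -/
lemma cs_except (q : ℤ) (g : F → ℤ) (m0 : F) (h : ∀ m, m ≠ m0 → |g m| ≤ 1) (h0 : |g m0| ≤ q) :
    |∑ m, g m| ≤ Fintype.card F + q := by
  have : ∀ m, |g m| ≤ 1 + (if m = m0 then q else 0) := by
    intro m
    by_cases hm : m = m0
    · rw [if_pos hm, hm]; linarith
    · rw [if_neg hm]; linarith [h m hm]
  refine (Finset.abs_sum_le_sum_abs _ _).trans ((Finset.sum_le_sum fun x _ => this x).trans ?_)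
  simp [Finset.sum_add_distrib]

lemma cs_sumprod (hF : ringChar F ≠ 2) (G : F → F → ℤ) :
    ∑ x, ∑ y, G (x + y) (x * y) = ∑ m, ∑ s, (1 + χ (s ^ 2 - 4 * m)) * G s m := by
  have h1 : ∀ x : F, ∑ y, G (x + y) (x * y) = ∑ s, G s (x * (s - x)) := by
    intro x
    rw [← Equiv.sum_comp (Equiv.addLeft x) (fun s => G s (x * (s - x)))]
    simp
  rw [Finset.sum_congr rfl fun x _ => h1 x, Finset.sum_comm, Finset.sum_comm (s := Finset.univ (α := F)) (f := fun m s => (1 + χ (s ^ 2 - 4 * m)) * G s m)]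
  refine Finset.sum_congr rfl fun s _ => ?_
  rw [cs_push (fun x : F => x * (s - x)) (fun m => G s m)]
  refine Finset.sum_congr rfl fun m _ => ?_
  congr 1
  have := cs_count hF 1 (-s) m one_ne_zero
  have e : (-s)^2 - 4 * 1 * m = s ^ 2 - 4 * m := by ring
  rw [← e, ← this]
  refine Finset.sum_congr rfl fun x _ => ?_
  congr 1
  rw [eq_iff_iff]
  constructor <;> intro h <;> linear_combination -h

lemma cs_recip (hF : ringChar F ≠ 2) (k : F) (hk : k ≠ 0) (g : F → ℤ) :
    ∑ u, (if u = 0 then 0 else g (u + k / u)) = ∑ n, (1 + χ (n ^ 2 - 4 * k)) * g n := by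
  have h1 : ∀ u, (if u = 0 then 0 else g (u + k / u)) = ∑ n, (if u ^ 2 + (-n) * u + k = 0 then 1 else 0) * g n := by
    intro u
    by_cases hu : u = 0
    · simp [hu, hk]
    · rw [if_neg hu]
      have : ∀ n, (u ^ 2 + (-n) * u + k = 0) ↔ (u + k / u = n) := by
        intro n
        constructor
        · intro h
          field_simp
          linear_combination h
        · intro h
          rw [← h]; field_simp; ring
      simp only [this]
      simp
  rw [Finset.sum_congr rfl fun x _ => h1 x, Finset.sum_comm]
  refine Finset.sum_congr rfl fun n _ => ?_
  rw [← Finset.sum_mul]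
  congr 1
  have := cs_count hF 1 (-n) k one_ne_zero
  have e : (-n)^2 - 4 * 1 * k = n ^ 2 - 4 * k := by ring
  rw [← e, ← this]
  simp

lemma cs_ratio (hF : ringChar F ≠ 2) (q1 q2 : F → F) :
    ∑ s, χ (q1 s) * χ (q2 s) = ∑ t, χ t * ∑ s, (if q1 s - t * q2 s = 0 then (1:ℤ) else 0) := by
  simp only [Finset.mul_sum]
  rw [Finset.sum_comm]
  refine Finset.sum_congr rfl fun s _ => ?_
  by_cases h2 : q2 s = 0
  · rw [h2]
    by_cases h1 : q1 s = 0
    · simp [h1, -quadraticChar_apply, quadraticChar_sum_zero hF]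
      exact quadraticChar_zero
    · simp [h1]
  · have : ∀ t, (q1 s - t * q2 s = 0) ↔ (q1 s / q2 s = t) := by
      intro t
      rw [sub_eq_zero, div_eq_iff h2]
    simp only [this]
    simp [-quadraticChar_apply]
    have e : q1 s = (q1 s / q2 s) * q2 s := by field_simp
    nth_rewrite 1 [e]
    rw [map_mul]
    linear_combination (χ (q1 s / q2 s)) * cs_mulself _ h2

/-- error in the count of roots -/
lemma cs_err (A B C : F) (h : A = 0) (hBC : B ≠ 0 ∨ C ≠ 0) :
    |(∑ x : F, if A * x ^ 2 + B * x + C = 0 then (1:ℤ) else 0) - (1 + χ (B ^ 2 - 4 * A * C))| ≤ 1 := by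
  subst h
  by_cases hB : B = 0
  · have hC : C ≠ 0 := by tauto
    simp [hB, hC]
  · have : ∀ x : F, (0 * x ^ 2 + B * x + C = 0) ↔ x = - C / B := by
      intro x
      rw [eq_div_iff hB]
      constructor <;> intro h <;> linear_combination h
    simp only [this]
    have e : B ^ 2 - 4 * 0 * C = B * B := by ring
    rw [e, map_mul, cs_mulself B hB]
    simp

lemma cs_err' (A B C : F) (h : A = 0) :
    |(∑ x : F, if A * x ^ 2 + B * x + C = 0 then (1:ℤ) else 0) - (1 + χ (B ^ 2 - 4 * A * C))| ≤ Fintype.card F + 2 := by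
  subst h
  have h1 : |∑ x : F, if 0 * x ^ 2 + B * x + C = 0 then (1:ℤ) else 0| ≤ Fintype.card F := by
    apply cs_abs_sum
    intro x; split_ifs <;> simp
  have h2 := cs_abs (B ^ 2 - 4 * 0 * C)
  rw [abs_le] at *
  constructor <;> linarith [h1.1, h1.2, h2.1, h2.2]

end CharSums

section Clausen
set_option linter.unusedSectionVars false
variable {F : Type} [Field F] [Fintype F] [DecidableEq F]

local notation "χ" => quadraticChar F

lemma cl_inner (hF : ringChar F ≠ 2) (c t : F) (hc : c ≠ 0) (ht : t ≠ 0) :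
    ∑ m, χ m * χ (4 * m + t * (m - c) ^ 2) = ∑ w, χ w * χ (w + 4 * c) * χ (4 + t * w) := by
  have h1 : ∀ m, χ m * χ (4 * m + t * (m - c) ^ 2) =
      if m = 0 then 0 else (fun n => χ (4 + t * (n - 2 * c))) (m + c ^ 2 / m) := by
    intro m
    by_cases hm : m = 0
    · simp [hm]
    · rw [if_neg hm]
      have e : 4 * m + t * (m - c) ^ 2 = m * (4 + t * (m + c ^ 2 / m - 2 * c)) := by
        field_simp; ring
      rw [e, map_mul, ← mul_assoc, cs_mulself m hm, one_mul]
  rw [Finset.sum_congr rfl fun m _ => h1 m, cs_recip hF (c ^ 2) (pow_ne_zero 2 hc) (fun n => χ (4 + t * (n - 2 * c)))]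
  simp only [add_mul, one_mul, Finset.sum_add_distrib]
  have h2 : ∑ n, χ (4 + t * (n - 2 * c)) = 0 := by
    rw [← cs_sum0 hF t (4 - t * (2 * c)) ht]
    refine Finset.sum_congr rfl fun n _ => ?_
    congr 1; ring
  rw [h2, zero_add, ← cs_affine (fun n => χ (n ^ 2 - 4 * c ^ 2) * χ (4 + t * (n - 2 * c))) 1 (2 * c) one_ne_zero]
  refine Finset.sum_congr rfl fun w _ => ?_
  simp only [← map_mul]
  congr 1
  ring

lemma cl_R' (hF : ringChar F ≠ 2) (h c l : F) (hc : c ≠ 0) (hl : h ^ 2 - 4 * c = - 4 * c * l) :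
    ∑ m, χ m * ∑ t, χ t * χ ((4 * m + t * (m - c) ^ 2) * (4 + t * (h ^ 2 - 4 * c)))
      = χ (-c) * ∑ v, ∑ x, χ v * χ (v - 1) * χ x * χ (x - 1) * χ (v - l * x) := by
  have h2 := cs_two hF
  have h4 : (4 : F) ≠ 0 := by
    have : (4 : F) = 2 * 2 := by norm_num
    rw [this]; exact mul_ne_zero h2 h2
  rw [hl]
  have s1 : ∑ m, χ m * ∑ t, χ t * χ ((4 * m + t * (m - c) ^ 2) * (4 + t * (- 4 * c * l)))
     = ∑ t, ∑ w, χ t * χ (4 + t * (-4 * c * l)) * (χ w * χ (w + 4 * c) * χ (4 + t * w)) := by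
    simp only [Finset.mul_sum]
    rw [Finset.sum_comm]
    refine Finset.sum_congr rfl fun t _ => ?_
    by_cases ht : t = 0
    · simp [ht]
    · rw [← Finset.mul_sum, ← cl_inner hF c t hc ht, Finset.mul_sum]
      refine Finset.sum_congr rfl fun m _ => ?_
      rw [map_mul]; ring
  rw [s1, Finset.sum_comm, ← cs_affine (fun w => ∑ t, χ t * χ (4 + t * (-4 * c * l)) * (χ w * χ (w + 4 * c) * χ (4 + t * w)))
    (-4 * c) 0 (mul_ne_zero (neg_ne_zero.mpr h4) hc), Finset.mul_sum]
  refine Finset.sum_congr rfl fun v _ => ?_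
  by_cases hv : v = 0
  · simp [hv]
  rw [← cs_affine (fun t => χ t * χ (4 + t * (-4 * c * l)) * (χ (-4 * c * v + 0) * χ (-4 * c * v + 0 + 4 * c) * χ (4 + t * (-4 * c * v + 0))))
    (1 / (c * v)) 0 (by simp [hc, hv]), Finset.mul_sum]
  refine Finset.sum_congr rfl fun x _ => ?_
  simp only [← map_mul]
  have e : (1 / (c * v) * x + 0) * (4 + (1 / (c * v) * x + 0) * (-4 * c * l)) *
        ((-4 * c * v + 0) * (-4 * c * v + 0 + 4 * c) * (4 + (1 / (c * v) * x + 0) * (-4 * c * v + 0)))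
      = (4 * 4 / v) ^ 2 * (-c * (v * (v - 1) * x * (x - 1) * (v - l * x))) := by
    field_simp; ring
  rw [e, map_mul, quadraticChar_sq_one' (by simp [h4, hv]), one_mul]

lemma cl_main (hF : ringChar F ≠ 2) (h c l : F) (hc : c ≠ 0) (hl0 : l ≠ 0) (hl : h ^ 2 - 4 * c = - 4 * c * l) :
    |∑ v, ∑ x, χ v * χ (v - 1) * χ x * χ (x - 1) * χ (v - l * x)|
      ≤ (∑ u, χ (u * (u ^ 2 + h * u + c))) ^ 2 + 4 * Fintype.card F + 2 := by
  have h2 := cs_two hF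
  have h4 : (4 : F) ≠ 0 := by
    have : (4 : F) = 2 * 2 := by norm_num
    rw [this]; exact mul_ne_zero h2 h2
  have hΔ : h ^ 2 - 4 * c ≠ 0 := by
    rw [hl]; exact mul_ne_zero (mul_ne_zero (neg_ne_zero.mpr h4) hc) hl0
  set T := ∑ v, ∑ x, χ v * χ (v - 1) * χ x * χ (x - 1) * χ (v - l * x) with hT
  set A := ∑ u, χ (u * (u ^ 2 + h * u + c)) with hA
  let Q : F → F → F := fun s m => c * s ^ 2 + (h * (m + c)) * s + ((m - c) ^ 2 + h ^ 2 * m)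
  have sA : A ^ 2 = ∑ m, χ m * ∑ s, χ (Q s m) + ∑ m, χ m * ∑ s, χ (s ^ 2 - 4 * m) * χ (Q s m) := by
    have a1 : A ^ 2 = ∑ u, ∑ v, (fun s m => χ m * χ (Q s m)) (u + v) (u * v) := by
      rw [sq, hA, Finset.sum_mul_sum]
      refine Finset.sum_congr rfl fun u _ => Finset.sum_congr rfl fun v _ => ?_
      simp only [← map_mul, Q]
      congr 1; ring
    rw [a1, cs_sumprod hF (fun s m => χ m * χ (Q s m)), ← Finset.sum_add_distrib]
    refine Finset.sum_congr rfl fun m _ => ?_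
    rw [Finset.mul_sum, Finset.mul_sum, ← Finset.sum_add_distrib]
    refine Finset.sum_congr rfl fun s _ => ?_
    ring
  have mulbd : ∀ (a b k : ℤ), |a| ≤ 1 → |b| ≤ k → |a * b| ≤ k := by
    intro a b k ha hb
    rw [abs_mul]
    calc |a| * |b| ≤ 1 * |b| := by gcongr
      _ ≤ k := by linarith
  have bI : |∑ m, χ m * ∑ s, χ (Q s m)| ≤ Fintype.card F + Fintype.card F := by
    apply cs_except _ _ c
    · intro m hm
      apply mulbd _ _ _ (cs_abs m)
      apply cs_quad_le hF _ _ _ hc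
      have : (h * (m + c)) ^ 2 - 4 * c * ((m - c) ^ 2 + h ^ 2 * m) = (h ^ 2 - 4 * c) * (m - c) ^ 2 := by ring
      rw [this]
      exact mul_ne_zero hΔ (pow_ne_zero 2 (sub_ne_zero.mpr hm))
    · apply mulbd _ _ _ (cs_abs c)
      exact cs_abs_sum _ fun x => cs_abs _
  let N : F → F → ℤ := fun m t => ∑ s : F, if (1 - t * c) * s ^ 2 + (- t * h * (m + c)) * s + (-4 * m - t * ((m - c) ^ 2 + h ^ 2 * m)) = 0 then (1:ℤ) else 0
  let D : F → F → F := fun m t => (- t * h * (m + c)) ^ 2 - 4 * (1 - t * c) * (-4 * m - t * ((m - c) ^ 2 + h ^ 2 * m))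
  have hD : ∀ m t, D m t = (4 * m + t * (m - c) ^ 2) * (4 + t * (h ^ 2 - 4 * c)) := by
    intro m t; simp only [D]; ring
  have sR : ∑ m, χ m * ∑ s, χ (s ^ 2 - 4 * m) * χ (Q s m) = ∑ m, χ m * ∑ t, χ t * N m t := by
    refine Finset.sum_congr rfl fun m _ => ?_
    rw [cs_ratio hF]
    congr 1
    refine Finset.sum_congr rfl fun t _ => ?_
    congr 1
    refine Finset.sum_congr rfl fun s _ => ?_
    congr 1
    simp only [Q]
    congr 1
    ring
  have sR' : ∑ m, χ m * ∑ t, χ t * χ (D m t) = χ (-c) * T := by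
    rw [hT, ← cl_R' hF h c l hc hl]
    simp only [hD]
  have sdiff : ∑ m, χ m * ∑ t, χ t * N m t - ∑ m, χ m * ∑ t, χ t * χ (D m t)
      = ∑ m, χ m * (χ c⁻¹ * (N m c⁻¹ - (1 + χ (D m c⁻¹)))) := by
    rw [← Finset.sum_sub_distrib]
    refine Finset.sum_congr rfl fun m _ => ?_
    rw [← mul_sub]
    congr 1
    have : ∑ t, χ t * χ (D m t) = ∑ t, χ t * (1 + χ (D m t)) := by
      simp only [mul_add, mul_one, Finset.sum_add_distrib]
      rw [quadraticChar_sum_zero hF, zero_add]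
    rw [this, ← Finset.sum_sub_distrib]
    simp only [← mul_sub]
    apply Finset.sum_eq_single c⁻¹
    · intro t _ ht
      have : N m t = 1 + χ (D m t) := by
        apply cs_count hF
        intro h0
        apply ht
        field_simp
        linear_combination -h0
      rw [this]; ring
    · simp
  have bE : |∑ m, χ m * (χ c⁻¹ * (N m c⁻¹ - (1 + χ (D m c⁻¹))))| ≤ Fintype.card F + (Fintype.card F + 2) := by
    have z : 1 - c⁻¹ * c = 0 := by field_simp; ring
    apply cs_except _ _ (-c)
    · intro m hm
      apply mulbd _ _ _ (cs_abs m)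
      apply mulbd _ _ _ (cs_abs _)
      apply cs_err _ _ _ z
      have hmc : m + c ≠ 0 := by intro h; exact hm (eq_neg_of_add_eq_zero_left h)
      by_cases hh : h = 0
      · right
        have : -4 * m - c⁻¹ * ((m - c) ^ 2 + h ^ 2 * m) = - c⁻¹ * (m + c) ^ 2 := by
          rw [hh]; field_simp; ring
        rw [this]; simp [hc, hmc]
      · left; simp [hc, hh, hmc]
    · apply mulbd _ _ _ (cs_abs _)
      apply mulbd _ _ _ (cs_abs _)
      exact cs_err' _ _ _ z
  have hχc : |T| = |χ (-c) * T| := by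
    have : |χ (-c)| = 1 := by
      rcases quadraticChar_dichotomy (neg_ne_zero.mpr hc) with h | h <;> rw [h] <;> simp
    rw [abs_mul, this, one_mul]
  rw [hχc]
  rw [sR', ← sR] at sdiff
  rw [← sdiff] at bE
  rw [abs_le] at *
  constructor <;> nlinarith [bE.1, bE.2, bI.1, bI.2, sq_nonneg A]

lemma cl_lin (hF : ringChar F ≠ 2) (ψ : F → ℤ) (hψ : ∀ u, |ψ u| ≤ 1) (l k : F) (hl : l ≠ 0) (hk : k ≠ 0) :
    |∑ u, ψ u * ∑ v, χ (k * u - l * v) * χ (v - 1)| ≤ Fintype.card F + Fintype.card F := by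
  have mulbd : ∀ (a b k : ℤ), |a| ≤ 1 → |b| ≤ k → |a * b| ≤ k := by
    intro a b k ha hb
    rw [abs_mul]
    calc |a| * |b| ≤ 1 * |b| := by gcongr
      _ ≤ k := by linarith
  apply cs_except _ _ (l / k)
  · intro u hu
    apply mulbd _ _ _ (hψ u)
    have : ∑ v, χ (k * u - l * v) * χ (v - 1) = ∑ v, χ ((-l) * v ^ 2 + (k * u + l) * v + (- (k * u))) := by
      refine Finset.sum_congr rfl fun v _ => ?_
      rw [← map_mul]; congr 1; ring
    rw [this]
    apply cs_quad_le hF _ _ _ (neg_ne_zero.mpr hl)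
    have : (k * u + l) ^ 2 - 4 * -l * -(k * u) = (k * u - l) ^ 2 := by ring
    rw [this]
    apply pow_ne_zero
    intro h
    apply hu
    field_simp
    linear_combination h
  · apply mulbd _ _ _ (hψ _)
    apply cs_abs_sum
    intro v
    exact mulbd _ _ _ (cs_abs _) (cs_abs _)

lemma cl_full (hF : ringChar F ≠ 2) (a : F) (ha : a ≠ 0) :
    |∑ b, ∑ c, χ (b ^ 2 - a ^ 2 * c ^ 2) * χ (b ^ 2 - 1) * χ (c ^ 2 - 1)|
      ≤ 6 * Fintype.card F + |∑ v, ∑ x, χ v * χ (v - 1) * χ x * χ (x - 1) * χ (v - a ^ 2 * x)| := by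
  set l := a ^ 2 with hl
  have hl0 : l ≠ 0 := pow_ne_zero 2 ha
  have e1 : ∑ b, ∑ c, χ (b ^ 2 - l * c ^ 2) * χ (b ^ 2 - 1) * χ (c ^ 2 - 1)
     = ∑ u, (1 + χ u) * ∑ v, (1 + χ v) * (χ (u - l * v) * χ (u - 1) * χ (v - 1)) := by
    rw [← cs_sqsum hF (fun u => ∑ v, (1 + χ v) * (χ (u - l * v) * χ (u - 1) * χ (v - 1)))]
    refine Finset.sum_congr rfl fun b _ => ?_
    rw [← cs_sqsum hF (fun v => χ (b ^ 2 - l * v) * χ (b ^ 2 - 1) * χ (v - 1))]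
  have e2 : ∑ u, (1 + χ u) * ∑ v, (1 + χ v) * (χ (u - l * v) * χ (u - 1) * χ (v - 1))
     = ∑ u, χ (u - 1) * ∑ v, χ (1 * u - l * v) * χ (v - 1)
     + ∑ u, (χ u * χ (u - 1)) * ∑ v, χ (1 * u - l * v) * χ (v - 1)
     + ∑ v, (χ (-1) * (χ v * χ (v - 1))) * ∑ u, χ (l * v - 1 * u) * χ (u - 1)
     + ∑ v, ∑ x, χ v * χ (v - 1) * χ x * χ (x - 1) * χ (v - l * x) := by
    simp only [Finset.mul_sum]
    rw [Finset.sum_comm (f := fun v u => χ (-1) * (χ v * χ (v - 1)) * (χ (l * v - 1 * u) * χ (u - 1)))]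
    simp only [← Finset.sum_add_distrib]
    refine Finset.sum_congr rfl fun u _ => Finset.sum_congr rfl fun v _ => ?_
    have : l * v - 1 * u = (-1) * (u - l * v) := by ring
    rw [this, map_mul, one_mul]
    linear_combination - (χ v * χ (v - 1) * χ (u - l * v) * χ (u - 1)) * cs_mulself (-1 : F) (by simp)
  have mulbd : ∀ (a b : ℤ), |a| ≤ 1 → |b| ≤ 1 → |a * b| ≤ 1 := by
    intro a b ha hb
    rw [abs_mul]
    calc |a| * |b| ≤ 1 * |b| := by gcongr
      _ ≤ 1 := by linarith
  have b1 := cl_lin hF (fun u => χ (u - 1)) (fun u => cs_abs _) l 1 hl0 one_ne_zero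
  have b2 := cl_lin hF (fun u => χ u * χ (u - 1)) (fun u => mulbd _ _ (cs_abs _) (cs_abs _)) l 1 hl0 one_ne_zero
  have b3 := cl_lin hF (fun u => χ (-1) * (χ u * χ (u - 1)))
    (fun u => mulbd _ _ (cs_abs _) (mulbd _ _ (cs_abs _) (cs_abs _))) 1 l one_ne_zero hl0
  rw [e1, e2]
  refine (abs_add_le _ _).trans ?_
  have := abs_add_le (∑ u, χ (u - 1) * ∑ v, χ (1 * u - l * v) * χ (v - 1)
     + ∑ u, (χ u * χ (u - 1)) * ∑ v, χ (1 * u - l * v) * χ (v - 1))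
     (∑ v, (χ (-1) * (χ v * χ (v - 1))) * ∑ u, χ (l * v - 1 * u) * χ (u - 1))
  have := abs_add_le (∑ u, χ (u - 1) * ∑ v, χ (1 * u - l * v) * χ (v - 1))
     (∑ u, (χ u * χ (u - 1)) * ∑ v, χ (1 * u - l * v) * χ (v - 1))
  linarith

end Clausen

section Final

lemma fin_T {p : ℕ} [Fact p.Prime] (hp : 100 ≤ p) (l : ZMod p) (hl : l ≠ 0) :
    |∑ v : ZMod p, ∑ x : ZMod p, quadraticChar (ZMod p) v * quadraticChar (ZMod p) (v - 1)
      * quadraticChar (ZMod p) x * quadraticChar (ZMod p) (x - 1) * quadraticChar (ZMod p) (v - l * x)|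
      ≤ 40010 * (p : ℤ) := by
  have hchar : ringChar (ZMod p) ≠ 2 := by rw [ZMod.ringChar_zmod_n]; omega
  obtain ⟨h, c, hc, hhc⟩ : ∃ h c : ZMod p, c ≠ 0 ∧ h ^ 2 - 4 * c = - 4 * c * l := by
    by_cases h1 : l = 1
    · exact ⟨0, 1, one_ne_zero, by rw [h1]; ring⟩
    · exact ⟨2 * (1 - l), 1 - l, sub_ne_zero.mpr (Ne.symm h1), by ring⟩
  have b1 := cl_main hchar h c l hc hl hhc
  have b2 := st_sum (Polynomial.X * (Polynomial.X ^ 2 + Polynomial.C h * Polynomial.X + Polynomial.C c) : Polynomial (ZMod p))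
    (by
      have : (Polynomial.X * (Polynomial.X ^ 2 + Polynomial.C h * Polynomial.X + Polynomial.C c) : Polynomial (ZMod p))
        = Polynomial.X ^ 3 + Polynomial.C h * Polynomial.X ^ 2 + Polynomial.C c * Polynomial.X := by ring
      rw [this]
      compute_degree!) hp
  simp only [Polynomial.eval_mul, Polynomial.eval_add, Polynomial.eval_pow, Polynomial.eval_X, Polynomial.eval_C] at b2
  rw [ZMod.card] at b1
  have : (100 : ℤ) ≤ p := by exact_mod_cast hp
  linarith

lemma fin_Icc {p : ℕ} [Fact p.Prime] (g : ZMod p → ℤ) :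
    ∑ b ∈ Finset.Icc 1 (p - 1), g (b : ZMod p) = ∑ x : ZMod p, g x - g 0 := by
  have hpp : p.Prime := Fact.out
  have h1 : ∑ x : ZMod p, g x = ∑ b ∈ Finset.range p, g (b : ZMod p) := by
    symm
    refine Finset.sum_bij (fun b _ => (b : ZMod p)) (fun _ _ => Finset.mem_univ _) ?_ ?_ (fun _ _ => rfl)
    · intro a ha b hb hab
      rw [ZMod.natCast_eq_natCast_iff'] at hab
      rwa [Nat.mod_eq_of_lt (Finset.mem_range.mp ha), Nat.mod_eq_of_lt (Finset.mem_range.mp hb)] at hab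
    · intro x _
      exact ⟨x.val, Finset.mem_range.mpr x.val_lt, ZMod.natCast_zmod_val x⟩
  have h2 : Finset.range p = insert 0 (Finset.Icc 1 (p-1)) := by
    ext x; have := hpp.pos; simp; omega
  rw [h1, h2, Finset.sum_insert (by simp)]
  simp

end Final

/-- For every odd prime `p` and `a ∈ F_p`, `a ≠ 0`, the double character sum
`Σ_{b,c=1}^{p-1} ((b²−a²c²)/p)((b²−1)/p)((c²−1)/p)` is `O(p)` with an absolute implied
constant. -/
theorem statement_2 : ∃ K : ℝ, 0 < K ∧ ∀ (p : ℕ) [Fact p.Prime], p ≠ 2 →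
    ∀ a : ZMod p, a ≠ 0 →
    |((∑ b ∈ Finset.Icc 1 (p - 1), ∑ c ∈ Finset.Icc 1 (p - 1),
        legendreSym p ((b : ℤ) ^ 2 - (a.val : ℤ) ^ 2 * (c : ℤ) ^ 2) *
          legendreSym p ((b : ℤ) ^ 2 - 1) *
          legendreSym p ((c : ℤ) ^ 2 - 1) : ℤ) : ℝ)|
      ≤ K * (p : ℝ) := by
  refine ⟨50000, by norm_num, ?_⟩
  intro p _ hp a ha
  have hpp : p.Prime := Fact.out
  have hchar : ringChar (ZMod p) ≠ 2 := by rwa [ZMod.ringChar_zmod_n]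
  set G : ZMod p → ZMod p → ℤ := fun b c => quadraticChar (ZMod p) (b ^ 2 - a ^ 2 * c ^ 2)
    * quadraticChar (ZMod p) (b ^ 2 - 1) * quadraticChar (ZMod p) (c ^ 2 - 1) with hG
  have hGle : ∀ b c, |G b c| ≤ 1 := by
    intro b c
    rw [hG]
    simp only [abs_mul]
    have h1 := cs_abs (b ^ 2 - a ^ 2 * c ^ 2)
    have h2 := cs_abs (b ^ 2 - 1)
    have h3 := cs_abs (c ^ 2 - 1)
    exact mul_le_one₀ (mul_le_one₀ h1 (abs_nonneg _) h2) (abs_nonneg _) h3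
  have e1 : (∑ b ∈ Finset.Icc 1 (p - 1), ∑ c ∈ Finset.Icc 1 (p - 1),
        legendreSym p ((b : ℤ) ^ 2 - (a.val : ℤ) ^ 2 * (c : ℤ) ^ 2) *
          legendreSym p ((b : ℤ) ^ 2 - 1) *
          legendreSym p ((c : ℤ) ^ 2 - 1) : ℤ)
      = (∑ b, ∑ c, G b c) - ∑ b, G b 0 - (∑ c, G 0 c - G 0 0) := by
    have : ∀ b : ℕ, ∑ c ∈ Finset.Icc 1 (p - 1),
        legendreSym p ((b : ℤ) ^ 2 - (a.val : ℤ) ^ 2 * (c : ℤ) ^ 2) *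
          legendreSym p ((b : ℤ) ^ 2 - 1) *
          legendreSym p ((c : ℤ) ^ 2 - 1) = (fun b : ZMod p => ∑ c, G b c - G b 0) (b : ZMod p) := by
      intro b
      simp only
      rw [← fin_Icc]
      refine Finset.sum_congr rfl fun c _ => ?_
      simp only [legendreSym, hG]
      push_cast
      rw [ZMod.natCast_zmod_val]
    rw [Finset.sum_congr rfl fun b _ => this b, fin_Icc (fun b : ZMod p => ∑ c, G b c - G b 0), Finset.sum_sub_distrib]
  have hz : |∑ b ∈ Finset.Icc 1 (p - 1), ∑ c ∈ Finset.Icc 1 (p - 1),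
        legendreSym p ((b : ℤ) ^ 2 - (a.val : ℤ) ^ 2 * (c : ℤ) ^ 2) *
          legendreSym p ((b : ℤ) ^ 2 - 1) *
          legendreSym p ((c : ℤ) ^ 2 - 1)| ≤ 50000 * (p : ℤ) := by
    rw [e1]
    have p2 : (2 : ℤ) ≤ p := by exact_mod_cast hpp.two_le
    have c1 : |∑ b, G b 0| ≤ p := by
      have := cs_abs_sum (fun b => G b 0) (fun b => hGle _ _)
      rwa [ZMod.card] at this
    have c2 : |∑ c, G 0 c| ≤ p := by
      have := cs_abs_sum (fun c => G 0 c) (fun b => hGle _ _)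
      rwa [ZMod.card] at this
    have c3 := hGle 0 0
    have main : |∑ b, ∑ c, G b c| ≤ 40020 * (p : ℤ) := by
      by_cases hp1 : 100 ≤ p
      · have f1 := cl_full hchar a ha
        have f2 := fin_T hp1 (a ^ 2) (pow_ne_zero 2 ha)
        rw [ZMod.card] at f1
        linarith
      · have : ∀ b, |∑ c, G b c| ≤ p := by
          intro b
          have := cs_abs_sum (fun c => G b c) (fun c => hGle _ _)
          rwa [ZMod.card] at this
        refine (Finset.abs_sum_le_sum_abs _ _).trans ((Finset.sum_le_sum fun b _ => this b).trans ?_)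
        simp
        push Not at hp1
        have : (p : ℤ) < 100 := by exact_mod_cast hp1
        nlinarith
    rw [abs_le] at *
    constructor <;> linarith [c1.1, c1.2, c2.1, c2.2, c3.1, c3.2, main.1, main.2]
  exact_mod_cast hz
end

section
/- There exists an absolute constant K > 0 such that for every odd prime p, |Σ_{a=1}^{p-1} Σ_{c=1}^{p-1} ((a²−c²)/p)·((c²−1)/p)·((a²−1)/p)| ≤ K·p. -/
namespace Stmt9

open Finset

variable {F : Type*} [Field F] [Fintype F] [DecidableEq F]

lemma mulLeft_app (t : F) (ht : t ≠ 0) (x : F) : Equiv.mulLeft₀ t ht x = t * x := rfl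

lemma norm_unit (A : MulChar F ℂ) {a : F} (ha : a ≠ 0) : ‖A a‖ = 1 := by
  have h := A.apply_mem_rootsOfUnity (Units.mk0 a ha)
  simpa using Complex.norm_eq_one_of_mem_rootsOfUnity h

lemma norm_le (A : MulChar F ℂ) (a : F) : ‖A a‖ ≤ 1 := by
  by_cases ha : a = 0
  · simp [ha, MulChar.map_zero]
  · exact (norm_unit A ha).le

lemma norm_jac (A B : MulChar F ℂ) (hA : A ≠ 1) (hB : B ≠ 1) (hAB : A * B ≠ 1) :
    ‖jacobiSum A B‖ ^ 2 = (Fintype.card F : ℝ) := by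
  have hc : ringChar ℂ ≠ ringChar F := by
    rw [ringChar.eq_zero]
    exact (CharP.ringChar_ne_zero_of_finite F).symm
  have h := jacobiSum_mul_jacobiSum_inv hc hA hB hAB
  have h2 : jacobiSum A⁻¹ B⁻¹ = (starRingEnd ℂ) (jacobiSum A B) := by
    simp only [jacobiSum, map_sum, map_mul]
    refine sum_congr rfl fun x _ => ?_
    rw [← MulChar.star_apply', ← MulChar.star_apply']
    rfl
  rw [h2, Complex.mul_conj, Complex.normSq_eq_norm_sq] at h
  exact_mod_cast h

lemma jac_shift (A B : MulChar F ℂ) (hAB : A * B ≠ 1) (t : F) :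
    ∑ v, A v * B (t - v) = (A * B) t * jacobiSum A B := by
  by_cases ht : t = 0
  · subst ht
    have : ∀ v : F, A v * B (0 - v) = B (-1) * (A * B) v := by
      intro v
      rw [show (0 : F) - v = (-1) * v by ring, map_mul, MulChar.mul_apply]; ring
    simp_rw [this]
    rw [← mul_sum, MulChar.sum_eq_zero_of_ne_one hAB]
    simp [MulChar.map_zero]
  · rw [jacobiSum, mul_sum]
    symm
    refine Fintype.sum_equiv (Equiv.mulLeft₀ t ht) _ _ fun x => ?_
    simp only [mulLeft_app]
    rw [show t - t * x = t * (1 - x) by ring, map_mul, map_mul, MulChar.mul_apply]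
    ring

/-- the quadratic character -/
noncomputable def chi (F : Type*) [Field F] [Fintype F] [DecidableEq F] : MulChar F ℂ :=
  (quadraticChar F).ringHomComp (Int.castRingHom ℂ)

lemma chi_apply (x : F) : chi F x = ((quadraticChar F x : ℤ) : ℂ) := rfl

lemma chi_ne_one (hF : ringChar F ≠ 2) : chi F ≠ 1 :=
  (MulChar.ringHomComp_ne_one_iff (RingHom.injective_int _)).2 (quadraticChar_ne_one hF)

lemma chi_quad : (chi F).IsQuadratic := (quadraticChar_isQuadratic F).comp _

lemma chi_sq : chi F * chi F = 1 := by rw [← sq]; exact chi_quad.sq_eq_one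

lemma sum_sq (hF : ringChar F ≠ 2) (f : F → ℂ) :
    ∑ a, f (a ^ 2) = ∑ x, (1 + chi F x) * f x := by
  rw [← Finset.sum_fiberwise (s := univ) (g := fun a : F => a ^ 2)]
  refine sum_congr rfl fun x _ => ?_
  have h : ∀ i ∈ univ.filter (fun a : F => a ^ 2 = x), f (i ^ 2) = f x := by
    intro i hi
    rw [(mem_filter.1 hi).2]
  rw [sum_congr rfl h, sum_const, nsmul_eq_mul]
  congr 1
  have := quadraticChar_card_sqrts hF x
  rw [chi_apply, add_comm]
  have h3 : ({x_1 : F | x_1 ^ 2 = x} : Set F).toFinset = univ.filter (fun a : F => a ^ 2 = x) := by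
    ext; simp
  rw [h3] at this
  exact_mod_cast this

lemma sum_symm (hF : ringChar F ≠ 2) (H : F → F → ℂ) :
    ∑ x, ∑ y, H (x + y) (x * y) =
      ∑ s, ∑ q, (1 + chi F (s ^ 2 - 4 * q)) * H s q := by
  have h2 : (2 : F) ≠ 0 := Ring.two_ne_zero hF
  have h4 : (4 : F) ≠ 0 := by
    rw [show (4 : F) = 2 * 2 by norm_num]; exact mul_ne_zero h2 h2
  have e1 : ∀ x : F, ∑ y, H (x + y) (x * y) = ∑ s, H s (x * (s - x)) := by
    intro x
    refine Fintype.sum_equiv (Equiv.addLeft x) _ _ fun y => ?_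
    simp
  simp_rw [e1]
  rw [sum_comm]
  refine sum_congr rfl fun s _ => ?_
  have e2 : ∑ x, H s (x * (s - x)) = ∑ d : F, H s ((s ^ 2 - d ^ 2) / 4) := by
    refine Fintype.sum_equiv ((Equiv.mulLeft₀ 2 h2).trans (Equiv.addRight (-s))) _ _ fun x => ?_
    simp only [Equiv.trans_apply, mulLeft_app, Equiv.coe_addRight]
    congr 1
    field_simp
    ring
  rw [e2, sum_sq hF (fun m => H s ((s ^ 2 - m) / 4))]
  symm
  refine Fintype.sum_equiv ((Equiv.mulLeft₀ 4 h4).trans (Equiv.subLeft (s ^ 2))) _ _ fun q => ?_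
  simp only [Equiv.trans_apply, mulLeft_app, Equiv.subLeft_apply]
  congr 2
  field_simp
  ring

lemma sum_theta (hF : ringChar F ≠ 2) (φ θ : MulChar F ℂ) (hθ : θ ≠ 1) (hφ : φ ≠ 1)
    (h : chi F * θ = φ) (s q : F) :
    ∑ h, θ (h ^ 2 - s * h + q) =
      θ (-1) * φ (4⁻¹) * jacobiSum (chi F) θ * φ (s ^ 2 - 4 * q) := by
  have h2 : (2 : F) ≠ 0 := Ring.two_ne_zero hF
  have h4 : (4 : F) ≠ 0 := by
    rw [show (4 : F) = 2 * 2 by norm_num]; exact mul_ne_zero h2 h2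
  set t : F := 4⁻¹ * (s ^ 2 - 4 * q) with ht
  have e1 : ∑ h, θ (h ^ 2 - s * h + q) = ∑ h, θ (h ^ 2 - t) := by
    refine Fintype.sum_equiv (Equiv.addRight (-(s / 2))) _ _ fun x => ?_
    simp only [Equiv.coe_addRight]
    congr 1
    rw [ht]
    have : (4 : F) = 2 * 2 := by norm_num
    rw [this]
    field_simp
    ring
  rw [e1, sum_sq hF (fun m => θ (m - t))]
  simp_rw [add_mul, one_mul]
  rw [sum_add_distrib]
  have e2 : ∑ m, θ (m - t) = 0 := by
    rw [← MulChar.sum_eq_zero_of_ne_one hθ]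
    exact Fintype.sum_equiv (Equiv.subRight t) _ _ fun x => rfl
  have e3 : ∀ m, chi F m * θ (m - t) = θ (-1) * (chi F m * θ (t - m)) := by
    intro m
    rw [show m - t = (-1) * (t - m) by ring, map_mul]; ring
  simp_rw [e3]
  rw [e2, ← mul_sum, jac_shift _ _ (by rw [h]; exact hφ), h, ht, map_mul]
  ring

lemma V_eval (hF : ringChar F ≠ 2) (φ θ : MulChar F ℂ) (hθ : θ ≠ 1) (hφ : φ ≠ 1)
    (h : chi F * θ = φ) (h' : chi F * φ = θ) (t : F) :
    ∑ s, ∑ q, chi F q * chi F (1 - s + q) * θ (t ^ 2 - s * t + q) =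
      chi F (-1) * (jacobiSum (chi F) θ * jacobiSum (chi F) φ) * (φ t * φ (t - 1)) := by
  rw [sum_comm]
  have e1 : ∀ u : F, ∑ s, chi F u * chi F (1 - s + u) * θ (t ^ 2 - s * t + u) =
      ∑ v, chi F u * (chi F v * θ ((t - 1) * (t - u) + t * v)) := by
    intro u
    refine Fintype.sum_equiv (Equiv.subLeft (1 + u)) _ _ fun s => ?_
    simp only [Equiv.subLeft_apply]
    rw [mul_assoc]
    congr 3 <;> ring_nf
  simp_rw [e1, ← mul_sum]
  by_cases ht : t = 0
  · subst ht
    simp only [zero_mul, add_zero, ← sum_mul, MulChar.sum_eq_zero_of_ne_one (chi_ne_one hF)]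
    simp [MulChar.map_zero]
  have e2 : ∀ w : F, ∑ v, chi F v * θ (w + t * v) =
      chi F (-t⁻¹) * (φ w * jacobiSum (chi F) θ) := by
    intro w
    rw [← h, ← jac_shift _ _ (by rw [h]; exact hφ), mul_sum]
    refine Fintype.sum_equiv (Equiv.mulLeft₀ (-t) (neg_ne_zero.2 ht)) _ _ fun v => ?_
    simp only [mulLeft_app]
    rw [← mul_assoc, ← map_mul]
    congr 2
    · field_simp
    · ring
  simp_rw [e2, map_mul]
  have e3 : ∀ u, chi F u * (chi F (-t⁻¹) * (φ (t - 1) * φ (t - u) * jacobiSum (chi F) θ)) =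
     (chi F (-t⁻¹) * φ (t - 1) * jacobiSum (chi F) θ) * (chi F u * φ (t - u)) := by
    intro u; ring
  simp_rw [e3]
  rw [← mul_sum, jac_shift _ _ (by rw [h']; exact hθ), h']
  have e4 : chi F (-t⁻¹) * θ t = chi F (-1) * φ t := by
    have h1 : chi F t * chi F t = 1 := by
      rw [← MulChar.mul_apply, chi_sq, MulChar.one_apply (Ne.isUnit ht)]
    have h2 : chi F (-t⁻¹) * chi F t = chi F (-1) := by
      rw [← map_mul]
      congr 1
      field_simp
    rw [← h, MulChar.mul_apply]
    linear_combination (chi F t * θ t) * h2 - (chi F (-t⁻¹) * θ t) * h1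
  linear_combination (φ (t - 1) * jacobiSum (chi F) θ * jacobiSum (chi F) φ) * e4

lemma U_bound (hF : ringChar F ≠ 2) (φ : MulChar F ℂ) (hφ2 : φ * φ = chi F) :
    ‖∑ s, ∑ q, chi F q * chi F (1 - s + q) * φ (s ^ 2 - 4 * q)‖ = Fintype.card F := by
  have h2 : (2 : F) ≠ 0 := Ring.two_ne_zero hF
  have h4 : (4 : F) ≠ 0 := by
    rw [show (4 : F) = 2 * 2 by norm_num]; exact mul_ne_zero h2 h2
  have hc := chi_ne_one hF
  have hφ : φ ≠ 1 := by
    rintro rfl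
    exact hc (by rw [← hφ2, one_mul])
  obtain ⟨θ, hθ⟩ : ∃ θ, θ = chi F * φ := ⟨_, rfl⟩
  have h : chi F * θ = φ := by rw [hθ, ← mul_assoc, chi_sq, one_mul]
  have hθ1 : θ ≠ 1 := by
    rintro rfl
    rw [mul_one] at h
    rw [← h, chi_sq] at hφ2
    exact hc hφ2.symm
  set U := ∑ s, ∑ q, chi F q * chi F (1 - s + q) * φ (s ^ 2 - 4 * q) with hU
  have key : (θ (-1) * φ (4⁻¹) * jacobiSum (chi F) θ) * U =
     chi F (-1) * (jacobiSum (chi F) θ * jacobiSum (chi F) φ) * (φ (-1) * jacobiSum φ φ) := by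
    have a1 : (θ (-1) * φ (4⁻¹) * jacobiSum (chi F) θ) * U =
        ∑ t, ∑ s, ∑ q, chi F q * chi F (1 - s + q) * θ (t ^ 2 - s * t + q) := by
      rw [sum_comm, hU, mul_sum]
      refine sum_congr rfl fun s _ => ?_
      rw [sum_comm, mul_sum]
      refine sum_congr rfl fun q _ => ?_
      rw [← mul_sum, sum_theta hF φ θ hθ1 hφ h]
      ring
    rw [a1]
    simp_rw [V_eval hF φ θ hθ1 hφ h hθ.symm]
    rw [← mul_sum]
    congr 1
    rw [jacobiSum, mul_sum]
    refine sum_congr rfl fun t _ => ?_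
    rw [show t - 1 = (-1) * (1 - t) by ring, map_mul]; ring
  have n1 := norm_jac (chi F) θ hc hθ1 (by rw [h]; exact hφ)
  have n2 := norm_jac (chi F) φ hc hφ (by rw [← hθ]; exact hθ1)
  have n3 := norm_jac φ φ hφ hφ (by rw [hφ2]; exact hc)
  have key2 := congrArg norm key
  have hm : (-1 : F) ≠ 0 := by simp
  simp only [norm_mul, norm_unit _ hm, norm_unit _ (inv_ne_zero h4), one_mul] at key2
  have hq : (0 : ℝ) < Fintype.card F := by exact_mod_cast Fintype.card_pos
  have hJ : ‖jacobiSum (chi F) θ‖ ≠ 0 := by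
    intro h0
    rw [h0] at n1
    norm_num at n1
    linarith
  have e23 : ‖jacobiSum (chi F) φ‖ = ‖jacobiSum φ φ‖ := by
    rw [← n3] at n2
    exact (sq_eq_sq₀ (norm_nonneg _) (norm_nonneg _)).1 n2
  rw [mul_assoc] at key2
  rw [mul_left_cancel₀ hJ key2, e23, ← sq, n3]

lemma exists_psi (hF : ringChar F ≠ 2) (hm : chi F (-1) = 1) : ∃ φ : MulChar F ℂ, φ * φ = chi F := by
  have hsq : IsSquare (-1 : F) := by
    rw [← quadraticChar_one_iff_isSquare (by simp)]
    rw [chi_apply] at hm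
    exact_mod_cast hm
  have h3 := FiniteField.isSquare_neg_one_iff.1 hsq
  have hodd := FiniteField.odd_card_of_char_ne_two hF
  have h4 : 4 ∣ Fintype.card F - 1 := by omega
  obtain ⟨φ, hφ⟩ := MulChar.exists_mulChar_orderOf F h4 (Complex.isPrimitiveRoot_exp 4 (by norm_num))
  refine ⟨φ, ?_⟩
  obtain ⟨g, hg⟩ := IsCyclic.exists_generator (α := Fˣ)
  have hφ4 : φ ^ 4 = 1 := by rw [← hφ]; exact pow_orderOf_eq_one φ
  have hφ2 : φ * φ ≠ 1 := by
    intro h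
    rw [← sq] at h
    have := orderOf_dvd_of_pow_eq_one h
    rw [hφ] at this
    norm_num at this
  have gen : ∀ A : MulChar F ℂ, A ≠ 1 → A * A = 1 → A g = -1 := by
    intro A hA hAA
    have h1 : A g ≠ 1 := by
      intro h
      apply hA
      rw [MulChar.eq_iff hg, h, MulChar.one_apply_coe]
    have h2 : A g * A g = 1 := by
      rw [← MulChar.mul_apply, hAA, MulChar.one_apply_coe]
    exact (mul_self_eq_one_iff.1 h2).resolve_left h1
  rw [MulChar.eq_iff hg, gen _ hφ2 (by rw [← hφ4, pow_succ, pow_succ, sq, mul_assoc]; simp only [mul_assoc]), gen _ (chi_ne_one hF) chi_sq]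

lemma T_bound (hF : ringChar F ≠ 2) :
    ‖∑ x, ∑ y, chi F x * chi F y * (chi F (x - y) * chi F (y - 1) * chi F (x - 1))‖
      ≤ 2 * Fintype.card F := by
  have hm : chi F (-1) = 1 ∨ chi F (-1) = -1 := by
    rcases chi_quad (F := F) (-1) with h | h | h
    · have := norm_unit (chi F) (a := -1) (by simp)
      rw [h] at this
      norm_num at this
    · exact Or.inl h
    · exact Or.inr h
  rcases hm with hm | hm
  · obtain ⟨φ, hφ⟩ := exists_psi hF hm
    have e1 : ∀ x y : F, chi F x * chi F y * (chi F (x - y) * chi F (y - 1) * chi F (x - 1)) =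
        chi F (x * y) * chi F (1 - (x + y) + x * y) * φ ((x + y) ^ 2 - 4 * (x * y)) := by
      intro x y
      rw [show (x + y) ^ 2 - 4 * (x * y) = (x - y) * (x - y) by ring,
        show 1 - (x + y) + x * y = (x - 1) * (y - 1) by ring, map_mul, map_mul, map_mul,
        ← MulChar.mul_apply φ φ, hφ]
      ring
    simp_rw [e1]
    rw [sum_symm hF (fun s q => chi F q * chi F (1 - s + q) * φ (s ^ 2 - 4 * q))]
    have e2 : ∀ s q : F, (1 + chi F (s ^ 2 - 4 * q)) *
        (chi F q * chi F (1 - s + q) * φ (s ^ 2 - 4 * q)) =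
        chi F q * chi F (1 - s + q) * φ (s ^ 2 - 4 * q) +
        chi F q * chi F (1 - s + q) * (chi F * φ) (s ^ 2 - 4 * q) := by
      intro s q
      rw [MulChar.mul_apply]; ring
    simp_rw [e2, sum_add_distrib]
    refine (norm_add_le _ _).trans ?_
    rw [U_bound hF φ hφ, U_bound hF (chi F * φ)
      (by rw [mul_mul_mul_comm, chi_sq, one_mul, hφ])]
    linarith
  · set T := ∑ x, ∑ y, chi F x * chi F y * (chi F (x - y) * chi F (y - 1) * chi F (x - 1)) with hT
    have : T = -T := by
      conv_lhs => rw [hT, sum_comm]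
      rw [hT, ← sum_neg_distrib]
      refine sum_congr rfl fun x _ => ?_
      rw [← sum_neg_distrib]
      refine sum_congr rfl fun y _ => ?_
      rw [show y - x = (-1) * (x - y) by ring, map_mul, hm]
      ring
    have h0 : T = 0 := self_eq_neg.1 this
    rw [h0, norm_zero]
    positivity

lemma inner_bound (hF : ringChar F ≠ 2) (x : F) (hx : x ≠ 1) :
    ‖∑ y, chi F (x - y) * chi F (y - 1)‖ ≤ 1 := by
  have hc := chi_ne_one hF
  have e : ∑ y, chi F (x - y) * chi F (y - 1) = jacobiSum (chi F) (chi F) := by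
    rw [jacobiSum]
    symm
    have hx' : x - 1 ≠ 0 := sub_ne_zero.2 hx
    refine Fintype.sum_equiv ((Equiv.mulLeft₀ (x - 1) hx').trans (Equiv.addRight 1)) _ _
      fun v => ?_
    simp only [Equiv.trans_apply, mulLeft_app, Equiv.coe_addRight]
    rw [show x - ((x - 1) * v + 1) = (x - 1) * (1 - v) by ring,
      show (x - 1) * v + 1 - 1 = (x - 1) * v by ring, map_mul, map_mul]
    have : chi F (x - 1) * chi F (x - 1) = 1 := by
      rw [← MulChar.mul_apply, chi_sq, MulChar.one_apply hx'.isUnit]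
    linear_combination -(chi F v * chi F (1 - v)) * this
  rw [e]
  nth_rw 2 [← chi_quad.inv]
  rw [jacobiSum_nontrivial_inv hc, norm_neg]
  exact norm_le _ _

lemma R_bound (hF : ringChar F ≠ 2) (w : F → ℂ) (C : ℝ) (hw : ∀ x, ‖w x‖ ≤ C) :
    ‖∑ x, ∑ y, w x * (chi F (x - y) * chi F (y - 1) * chi F (x - 1))‖
      ≤ C * Fintype.card F := by
  have hC : 0 ≤ C := (norm_nonneg _).trans (hw 0)
  have : ∀ x ∈ (univ : Finset F),
      ‖∑ y, w x * (chi F (x - y) * chi F (y - 1) * chi F (x - 1))‖ ≤ C := by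
    intro x _
    rw [← mul_sum, ← sum_mul]
    by_cases hx : x = 1
    · simp [hx, hC, MulChar.map_zero]
    · rw [norm_mul, norm_mul]
      calc _ ≤ C * (1 * 1) := by
            gcongr
            · exact hw x
            · exact inner_bound hF x hx
            · exact norm_le _ _
        _ = C := by ring
  refine (norm_sum_le_of_le _ this).trans ?_
  simp [mul_comm]

lemma full_bound (hF : ringChar F ≠ 2) :
    ‖∑ a : F, ∑ c : F, chi F (a ^ 2 - c ^ 2) * chi F (c ^ 2 - 1) * chi F (a ^ 2 - 1)‖
      ≤ 5 * Fintype.card F := by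
  have e : ∑ a : F, ∑ c : F, chi F (a ^ 2 - c ^ 2) * chi F (c ^ 2 - 1) * chi F (a ^ 2 - 1) =
      ∑ x, ∑ y, (1 + chi F x) * (chi F (x - y) * chi F (y - 1) * chi F (x - 1)) +
      chi F (-1) * ∑ x, ∑ y, chi F x * (chi F (x - y) * chi F (y - 1) * chi F (x - 1)) +
      ∑ x, ∑ y, chi F x * chi F y * (chi F (x - y) * chi F (y - 1) * chi F (x - 1)) := by
    have a1 : ∀ a : F, ∑ c : F, chi F (a ^ 2 - c ^ 2) * chi F (c ^ 2 - 1) * chi F (a ^ 2 - 1) =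
        ∑ y, (1 + chi F y) * (chi F (a ^ 2 - y) * chi F (y - 1) * chi F (a ^ 2 - 1)) := fun a =>
      sum_sq hF (fun y => chi F (a ^ 2 - y) * chi F (y - 1) * chi F (a ^ 2 - 1))
    simp_rw [a1]
    rw [sum_sq hF (fun x => ∑ y, (1 + chi F y) * (chi F (x - y) * chi F (y - 1) * chi F (x - 1)))]
    have a2 : chi F (-1) * ∑ x, ∑ y, chi F x * (chi F (x - y) * chi F (y - 1) * chi F (x - 1)) =
        ∑ x, ∑ y, chi F y * (chi F (x - y) * chi F (y - 1) * chi F (x - 1)) := by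
      rw [sum_comm, mul_sum]
      refine sum_congr rfl fun x _ => ?_
      rw [mul_sum]
      refine sum_congr rfl fun y _ => ?_
      rw [show x - y = (-1) * (y - x) by ring, map_mul]
      ring
    rw [a2, ← sum_add_distrib, ← sum_add_distrib]
    refine sum_congr rfl fun x _ => ?_
    rw [← sum_add_distrib, ← sum_add_distrib, mul_sum]
    refine sum_congr rfl fun y _ => ?_
    ring
  rw [e]
  have b1 := R_bound hF (fun x => 1 + chi F x) 2 (fun x => by
    refine (norm_add_le _ _).trans ?_
    have := norm_le (chi F) x
    rw [norm_one]; linarith)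
  have b2 := R_bound hF (fun x => chi F x) 1 (norm_le _)
  have b3 := T_bound hF
  refine (norm_add_le _ _).trans ?_
  refine (add_le_add_left (norm_add_le _ _) _).trans ?_
  rw [norm_mul, norm_unit _ (by simp : (-1 : F) ≠ 0)]
  linarith

end Stmt9

lemma stmt9_sum (p : ℕ) [Fact p.Prime] (f : ZMod p → ℂ) :
    ∑ a ∈ Finset.Icc 1 (p - 1), f (a : ZMod p) = ∑ a, f a - f 0 := by
  have hp : 0 < p := (Fact.out : p.Prime).pos
  have h1 : ∑ a, f a = ∑ a ∈ Finset.range p, f (a : ZMod p) := by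
    symm
    refine Finset.sum_bij (fun a _ => (a : ZMod p)) (by simp) ?_ ?_ (by simp)
    · intro a ha b hb h
      rw [ZMod.natCast_eq_natCast_iff', Nat.mod_eq_of_lt (Finset.mem_range.1 ha),
        Nat.mod_eq_of_lt (Finset.mem_range.1 hb)] at h
      exact h
    · intro b _
      exact ⟨b.val, Finset.mem_range.2 (ZMod.val_lt b), by simp⟩
  have h2 : Finset.range p = insert 0 (Finset.Icc 1 (p - 1)) := by
    ext a; simp; omega
  rw [h1, h2, Finset.sum_insert (by simp)]
  simp

/-- For every odd prime `p`, the character sum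
`Σ_{a,c=1}^{p-1} ((a²−c²)/p)((c²−1)/p)((a²−1)/p)` is `O(p)` with an absolute implied
constant. -/
theorem statement_9 : ∃ K : ℝ, 0 < K ∧ ∀ (p : ℕ) [Fact p.Prime], p ≠ 2 →
    |((∑ a ∈ Finset.Icc 1 (p - 1), ∑ c ∈ Finset.Icc 1 (p - 1),
        legendreSym p ((a : ℤ) ^ 2 - (c : ℤ) ^ 2) *
          legendreSym p ((c : ℤ) ^ 2 - 1) *
          legendreSym p ((a : ℤ) ^ 2 - 1) : ℤ) : ℝ)|
      ≤ K * (p : ℝ) := by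
  refine ⟨7, by norm_num, ?_⟩
  intro p _ hp2
  have hF : ringChar (ZMod p) ≠ 2 := by rwa [ZMod.ringChar_zmod_n]
  have hb := Stmt9.full_bound hF
  rw [ZMod.card] at hb
  rw [← Complex.norm_intCast]
  push_cast
  let g : ZMod p → ZMod p → ℂ := fun a c => Stmt9.chi (ZMod p) (a ^ 2 - c ^ 2) *
    Stmt9.chi (ZMod p) (c ^ 2 - 1) * Stmt9.chi (ZMod p) (a ^ 2 - 1)
  have hg : ∀ a c, ‖g a c‖ ≤ 1 := by
    intro a c
    simp only [g, norm_mul]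
    have h1 := Stmt9.norm_le (Stmt9.chi (ZMod p))
    exact mul_le_one₀ (mul_le_one₀ (h1 _) (norm_nonneg _) (h1 _)) (norm_nonneg _) (h1 _)
  have e : ∀ a c : ℕ, ((legendreSym p ((a : ℤ) ^ 2 - (c : ℤ) ^ 2) : ℤ) : ℂ) *
      ((legendreSym p ((c : ℤ) ^ 2 - 1) : ℤ) : ℂ) * ((legendreSym p ((a : ℤ) ^ 2 - 1) : ℤ) : ℂ) =
      g a c := by
    intro a c
    simp only [g, Stmt9.chi_apply, legendreSym]
    push_cast
    rfl
  simp_rw [e]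
  have e2 : ∑ a ∈ Finset.Icc 1 (p - 1), ∑ c ∈ Finset.Icc 1 (p - 1), g a c =
      ∑ a, ∑ c, g a c - ∑ a, g a 0 - ∑ c ∈ Finset.Icc 1 (p - 1), g 0 c := by
    have : ∀ a : ZMod p, ∑ c ∈ Finset.Icc 1 (p - 1), g a c = ∑ c, g a c - g a 0 := fun a =>
      stmt9_sum p (g a)
    simp_rw [this]
    rw [stmt9_sum p (fun a => ∑ c, g a c - g a 0), Finset.sum_sub_distrib]
  rw [e2]
  have b1 : ‖∑ a, g a 0‖ ≤ p := by
    refine (norm_sum_le_of_le _ (fun a _ => hg a 0)).trans ?_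
    simp
  have b2 : ‖∑ c ∈ Finset.Icc 1 (p - 1), g 0 c‖ ≤ p := by
    refine (norm_sum_le_of_le _ (fun (c : ℕ) _ => hg 0 (c : ZMod p))).trans ?_
    simp
  refine (norm_sub_le _ _).trans ?_
  have := norm_sub_le (∑ a, ∑ c, g a c) (∑ a, g a 0)
  have hb' : ‖∑ a, ∑ c, g a c‖ ≤ 5 * p := hb
  linarith
end

section
/- There exists an absolute constant K > 0 such that for every odd prime p and every a ∈ F_p with a ≠ 0, one has |Σ_{c=1}^{p-1} ((c²−c)/p)·φ(a²c)| ≤ K·p, where φ(t) = Σ_{b=1}^{p-1} ((b−t)/p)·((b−1)/p)·(b/p). -/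
/-- For an odd prime `p` and `t : ℤ`, `φ(t) = Σ_{b=1}^{p-1} ((b−t)/p)((b−1)/p)(b/p)`. -/
def phiFun (p : ℕ) [Fact p.Prime] (t : ℤ) : ℤ :=
  ∑ b ∈ Finset.Icc 1 (p - 1),
    legendreSym p ((b : ℤ) - t) * legendreSym p ((b : ℤ) - 1) * legendreSym p (b : ℤ)

section
open Polynomial

noncomputable def stR {p : ℕ} [Fact p.Prime] (f : (ZMod p)[X]) (n : ℕ) :
    ℕ → ((ZMod p)[X] →ₗ[ZMod p] (ZMod p)[X])
  | 0 => LinearMap.id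
  | l + 1 => (LinearMap.mulLeft (ZMod p) (((n - l : ℕ) : (ZMod p)[X]) * derivative f)) ∘ₗ stR f n l
      + (LinearMap.mulLeft (ZMod p) f) ∘ₗ derivative ∘ₗ stR f n l

lemma stR_succ {p : ℕ} [Fact p.Prime] (f : (ZMod p)[X]) (n l : ℕ) (r : (ZMod p)[X]) :
    stR f n (l+1) r = ((n - l : ℕ) : (ZMod p)[X]) * derivative f * stR f n l r
      + f * derivative (stR f n l r) := by
  simp [stR, mul_assoc]

lemma stR_deriv {p : ℕ} [Fact p.Prime] (f : (ZMod p)[X]) (n : ℕ) (r : (ZMod p)[X]) (l : ℕ)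
    (hl : l ≤ n) : derivative^[l] (f ^ n * r) = f ^ (n - l) * stR f n l r := by
  induction l with
  | zero => simp [stR]
  | succ l ih =>
    rw [Function.iterate_succ_apply', ih (by omega), stR_succ, derivative_mul, derivative_pow]
    have h1 : n - l = (n - (l+1)) + 1 := by omega
    rw [h1]
    simp only [Nat.add_sub_cancel, pow_succ, map_natCast]
    ring

lemma stR_deg {p : ℕ} [Fact p.Prime] (f : (ZMod p)[X]) (hf : f.natDegree = 3) (n : ℕ)
    (r : (ZMod p)[X]) (B : ℕ) (hr : r.natDegree ≤ B) (l : ℕ) :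
    (stR f n l r).natDegree ≤ B + 2 * l := by
  induction l with
  | zero => simpa [stR] using hr
  | succ l ih =>
    rw [stR_succ]
    have hfd : (derivative f).natDegree ≤ 2 := by
      have := natDegree_derivative_le f; omega
    apply natDegree_add_le_of_degree_le
    · refine (natDegree_mul_le_of_le (m := 2) (n := B + 2 * l) ?_ ih).trans (by omega)
      refine (natDegree_mul_le_of_le (m := 0) (n := 2) (by simp) hfd).trans (by omega)
    · by_cases h0 : (stR f n l r).natDegree = 0
      · rw [derivative_of_natDegree_zero h0]; simp
      · have := natDegree_derivative_lt h0
        refine (natDegree_mul_le_of_le (m := 3) (n := B + 2 * l - 1) (by omega) (by omega)).trans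
          (by omega)

lemma deriv_Xp {p : ℕ} [Fact p.Prime] (j l : ℕ) (q : (ZMod p)[X]) :
    derivative^[l] (X ^ (p * j) * q) = X ^ (p * j) * derivative^[l] q := by
  induction l with
  | zero => simp
  | succ l ih =>
    rw [Function.iterate_succ_apply', Function.iterate_succ_apply', ih, derivative_mul]
    have : derivative (X ^ (p * j) : (ZMod p)[X]) = 0 := by
      rw [derivative_X_pow]; simp
    rw [this]; simp

/-- key step -/
lemma st_base {p : ℕ} [Fact p.Prime] (h2 : p ≠ 2) (f : (ZMod p)[X]) (hf : f.natDegree = 3)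
    (h0 : f.coeff 0 ≠ 0) (r s : (ZMod p)[X]) (hr : 2 * r.natDegree + 3 < p)
    (hs : 2 * s.natDegree + 3 < p)
    (h : X ^ p ∣ r + f ^ ((p - 1) / 2) * s) : r = 0 ∧ s = 0 := by
  have hp : p.Prime := Fact.out
  have hodd := hp.eq_two_or_odd.resolve_left h2
  have hpp : 2 * ((p - 1) / 2) + 1 = p := by omega
  set g := f ^ ((p - 1) / 2) with hg
  have hfg : f * g ^ 2 = f ^ p := by
    rw [hg, ← pow_mul, ← pow_succ']; congr 1; omega
  have hfp : X ^ p ∣ f ^ p - C (f.coeff 0) := by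
    have e1 : f ^ p = expand (ZMod p) p f := (ZMod.expand_card f).symm
    have : X ∣ f - C (f.coeff 0) := by
      rw [X_dvd_iff]; simp
    have h3 := map_dvd (expand (ZMod p) p) this
    simpa [e1] using h3
  have h4 : X ^ p ∣ f * r ^ 2 - C (f.coeff 0) * s ^ 2 := by
    have e : f * r ^ 2 - C (f.coeff 0) * s ^ 2
        = (r + g * s) * (f * (r - g * s)) + (f ^ p - C (f.coeff 0)) * s ^ 2 := by
      rw [← hfg]; ring
    rw [e]
    exact dvd_add (Dvd.dvd.mul_right h _) (Dvd.dvd.mul_right hfp _)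
  have hfne : f ≠ 0 := by rintro rfl; simp at hf
  have h5 : f * r ^ 2 - C (f.coeff 0) * s ^ 2 = 0 := by
    by_contra hne
    have := natDegree_le_of_dvd h4 hne
    rw [natDegree_X_pow] at this
    have h6 : (f * r ^ 2 - C (f.coeff 0) * s ^ 2).natDegree ≤ p - 1 := by
      refine (natDegree_sub_le_of_le (m := p - 1) (n := p - 1) ?_ ?_).trans (by simp)
      · refine (natDegree_mul_le_of_le (m := 3) (n := 2 * r.natDegree) (by omega)
          natDegree_pow_le).trans (by omega)
      · refine (natDegree_mul_le_of_le (m := 0) (n := 2 * s.natDegree) (by simp)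
          natDegree_pow_le).trans (by omega)
    omega
  have h7 : f * r ^ 2 = C (f.coeff 0) * s ^ 2 := sub_eq_zero.mp h5
  have hr0 : r = 0 := by
    by_contra hr0
    have hs0 : s ≠ 0 := by
      rintro rfl
      simp [hfne, hr0] at h7
    have := congrArg natDegree h7
    rw [natDegree_mul hfne (pow_ne_zero _ hr0), natDegree_C_mul h0, natDegree_pow, natDegree_pow]
      at this
    omega
  refine ⟨hr0, ?_⟩
  subst hr0
  have : C (f.coeff 0) * s ^ 2 = 0 := by rw [← h7]; ring
  simpa [h0] using this

lemma st_indep_s15 {p : ℕ} [Fact p.Prime] (h2 : p ≠ 2) (f : (ZMod p)[X]) (hf : f.natDegree = 3)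
    (h0 : f.coeff 0 ≠ 0) (J : ℕ) : ∀ (r s : ℕ → (ZMod p)[X]),
    (∀ j, 2 * (r j).natDegree + 3 < p) → (∀ j, 2 * (s j).natDegree + 3 < p) →
    (∑ j ∈ Finset.range J, X ^ (p * j) * (r j + f ^ ((p - 1) / 2) * s j) = 0) →
    ∀ j < J, r j = 0 ∧ s j = 0 := by
  induction J with
  | zero => intro _ _ _ _ _ j hj; omega
  | succ J ih =>
    intro r s hr hs h
    rw [Finset.sum_range_succ'] at h
    have e : ∑ j ∈ Finset.range J, X ^ (p * (j+1)) * (r (j+1) + f ^ ((p - 1) / 2) * s (j+1))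
       = X ^ p * ∑ j ∈ Finset.range J, X ^ (p * j) * (r (j+1) + f ^ ((p - 1) / 2) * s (j+1)) := by
      rw [Finset.mul_sum]
      refine Finset.sum_congr rfl fun j _ => ?_
      ring
    rw [e] at h
    simp only [mul_zero, pow_zero, one_mul] at h
    have hb : r 0 = 0 ∧ s 0 = 0 := by
      apply st_base h2 f hf h0 _ _ (hr 0) (hs 0)
      exact (dvd_add_right (Dvd.intro _ rfl)).mp (h ▸ dvd_zero _)
    rw [hb.1, hb.2] at h
    simp only [mul_zero, add_zero, mul_eq_zero] at h
    have h' := h.resolve_left (pow_ne_zero _ X_ne_zero)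
    have := ih (fun j => r (j+1)) (fun j => s (j+1)) (fun j => hr _) (fun j => hs _) h'
    rintro (_ | j) hj
    · exact hb
    · exact this j (by omega)

lemma st_exists {p : ℕ} [Fact p.Prime] (f : (ZMod p)[X]) (hf : f.natDegree = 3)
    (e : ZMod p) (B M J n : ℕ) (hB : 1 ≤ B) (hc : M * (B + 2 * M + J) < 2 * J * B) :
    ∃ r s : ℕ → (ZMod p)[X], (∀ j, (r j).natDegree ≤ B - 1) ∧ (∀ j, (s j).natDegree ≤ B - 1) ∧
      (∃ j < J, r j ≠ 0 ∨ s j ≠ 0) ∧ ∀ l < M,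
      ∑ j ∈ Finset.range J, X ^ j * (stR f M l (r j) + C e * stR f n l (s j)) = 0 := by
  classical
  let L : Fin M → ((Fin J → (degreeLT (ZMod p) B × degreeLT (ZMod p) B)) →ₗ[ZMod p] (ZMod p)[X]) :=
    fun l => ∑ j : Fin J, (LinearMap.mulLeft (ZMod p) (X ^ (j : ℕ))) ∘ₗ
      (stR f M l ∘ₗ (degreeLT (ZMod p) B).subtype ∘ₗ LinearMap.fst _ _ _ ∘ₗ LinearMap.proj j
       + (LinearMap.mulLeft (ZMod p) (C e)) ∘ₗ stR f n l ∘ₗ (degreeLT (ZMod p) B).subtype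
          ∘ₗ LinearMap.snd _ _ _ ∘ₗ LinearMap.proj j)
  have hL : ∀ l v, L l v = ∑ j : Fin J, X ^ (j : ℕ) *
      (stR f M l ((v j).1 : (ZMod p)[X]) + C e * stR f n l ((v j).2 : (ZMod p)[X])) := by
    intro l v
    simp only [L, LinearMap.sum_apply]
    rfl
  let Φ : (Fin J → (degreeLT (ZMod p) B × degreeLT (ZMod p) B)) →ₗ[ZMod p]
      (Fin M × Fin (B + 2 * M + J) → ZMod p) :=
    LinearMap.pi fun q => (lcoeff (ZMod p) (q.2 : ℕ)) ∘ₗ L q.1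
  have hfr : Module.finrank (ZMod p) (degreeLT (ZMod p) B) = B := by
    rw [(degreeLTEquiv (ZMod p) B).finrank_eq]; simp
  have hker : LinearMap.ker Φ ≠ ⊥ := by
    apply LinearMap.ker_ne_bot_of_finrank_lt
    rw [Module.finrank_pi, Module.finrank_pi_fintype]
    simp only [Module.finrank_prod, hfr, Fintype.card_prod, Fintype.card_fin, Finset.sum_const,
      Finset.card_univ, smul_eq_mul]
    calc _ < _ := hc
      _ = _ := by ring
  obtain ⟨v, hv, hv0⟩ := Submodule.exists_mem_ne_zero_of_ne_bot hker
  have hdeg : ∀ q : degreeLT (ZMod p) B, (q : (ZMod p)[X]).natDegree ≤ B - 1 := by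
    rintro ⟨q, hq⟩
    rw [mem_degreeLT] at hq
    by_cases h : q = 0
    · simp [h]
    · have := (natDegree_lt_iff_degree_lt h).mpr hq
      simp only; omega
  refine ⟨fun j => if h : j < J then ((v ⟨j, h⟩).1 : (ZMod p)[X]) else 0,
    fun j => if h : j < J then ((v ⟨j, h⟩).2 : (ZMod p)[X]) else 0, ?_, ?_, ?_, ?_⟩
  · intro j; dsimp only; split_ifs
    · exact hdeg _
    · simp
  · intro j; dsimp only; split_ifs
    · exact hdeg _
    · simp
  · obtain ⟨j, hj⟩ := Function.ne_iff.mp hv0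
    refine ⟨j, j.2, ?_⟩
    simp only [j.2, dite_true, Fin.eta]
    by_contra hcon
    push Not at hcon
    apply hj
    ext1
    · exact Subtype.ext hcon.1
    · exact Subtype.ext hcon.2
  · intro l hl
    rw [Finset.sum_range]
    simp only [Fin.is_lt, dite_true, Fin.eta]
    rw [← hL ⟨l, hl⟩ v]
    ext i
    rw [coeff_zero]
    by_cases hi : i < B + 2 * M + J
    · have := congrFun (LinearMap.mem_ker.mp hv) (⟨l, hl⟩, ⟨i, hi⟩)
      simpa [Φ] using this
    · apply coeff_eq_zero_of_natDegree_lt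
      refine lt_of_le_of_lt (b := B + 2 * M + J - 1) ?_ (by omega)
      rw [hL]
      apply natDegree_sum_le_of_forall_le
      intro j _
      have a1 := stR_deg f hf M _ _ (hdeg (v j).1) l
      have a2 := stR_deg f hf n _ _ (hdeg (v j).2) l
      have := j.2
      refine (natDegree_mul_le_of_le (m := j) (n := B - 1 + 2 * l) (by simp) ?_).trans (by omega)
      refine natDegree_add_le_of_degree_le a1 ?_
      exact (natDegree_C_mul_le _ _).trans a2

lemma st_count {p : ℕ} [Fact p.Prime] (h2 : p ≠ 2) (f : (ZMod p)[X]) (hf : f.natDegree = 3)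
    (h0 : f.coeff 0 ≠ 0) (e : ZMod p) (B M J : ℕ) (hB : 1 ≤ B) (hBp : 2 * B + 1 < p)
    (hM : 1 ≤ M) (hMp : M < p) (hc : M * (B + 2 * M + J) < 2 * J * B)
    (S : Finset (ZMod p)) (hS : ∀ x ∈ S, (f.eval x) ^ ((p - 1) / 2) = e) :
    M * S.card ≤ 3 * M + B + 3 * ((p - 1) / 2) + p * (J - 1) := by
  classical
  obtain ⟨r, s, hr, hs, ⟨j0, hj0, hne⟩, hz⟩ := st_exists f hf e B M J (M + (p - 1) / 2) hB hc
  set h := (p - 1) / 2 with hh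
  set F : (ZMod p)[X] := ∑ j ∈ Finset.range J, X ^ (p * j) * (f ^ M * r j + f ^ (M + h) * s j)
    with hF
  have hfne : f ≠ 0 := by rintro rfl; simp at hf
  have hFe : F = f ^ M * ∑ j ∈ Finset.range J, X ^ (p * j) * (r j + f ^ h * s j) := by
    rw [hF, Finset.mul_sum]
    refine Finset.sum_congr rfl fun j _ => ?_
    ring
  have hF0 : F ≠ 0 := by
    rw [hFe]
    refine mul_ne_zero (pow_ne_zero _ hfne) fun hsum => ?_
    have := st_indep_s15 h2 f hf h0 J r s (fun j => by have := hr j; omega)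
      (fun j => by have := hs j; omega) hsum j0 hj0
    tauto
  have hder : ∀ l < M, ∀ x ∈ S, (derivative^[l] F).IsRoot x := by
    intro l hl x hx
    have e1 : derivative^[l] F = ∑ j ∈ Finset.range J, X ^ (p * j) *
        (f ^ (M - l) * stR f M l (r j) + f ^ (M + h - l) * stR f (M + h) l (s j)) := by
      rw [hF, iterate_derivative_sum]
      refine Finset.sum_congr rfl fun j _ => ?_
      rw [deriv_Xp, iterate_map_add, stR_deriv _ _ _ _ hl.le,
        stR_deriv _ _ _ _ (by omega)]
    have e2 := congrArg (eval x) (hz l hl)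
    rw [IsRoot, e1, eval_finsetSum]
    rw [eval_finsetSum] at e2
    have e3 : M + h - l = (M - l) + h := by omega
    calc _ = (f.eval x) ^ (M - l) * ∑ j ∈ Finset.range J, eval x
          (X ^ j * (stR f M l (r j) + C e * stR f (M + h) l (s j))) := by
          rw [Finset.mul_sum]
          refine Finset.sum_congr rfl fun j _ => ?_
          simp only [eval_mul, eval_add, eval_pow, eval_X, eval_C, e3]
          rw [pow_mul, ZMod.pow_card, pow_add, hS x hx]
          ring
      _ = 0 := by rw [e2]; simp
  have hmult : ∀ x ∈ S, M ≤ F.rootMultiplicity x := by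
    intro x hx
    have := lt_rootMultiplicity_of_isRoot_iterate_derivative_of_mem_nonZeroDivisors' (n := M - 1)
      (t := x) hF0 (fun m hm => hder m (by omega) x hx) (fun m hm hm0 => by
        rw [mem_nonZeroDivisors_iff_ne_zero, Ne, ZMod.natCast_eq_zero_iff]
        intro hd
        have := Nat.le_of_dvd (by omega) hd
        omega)
    omega
  have hdegF : F.natDegree ≤ 3 * M + B + 3 * h + p * (J - 1) := by
    rw [hF]
    apply natDegree_sum_le_of_forall_le
    intro j hj
    have hj' := Finset.mem_range.mp hj
    have q1 : p * j ≤ p * (J - 1) := Nat.mul_le_mul_left _ (by omega)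
    have a1 := hr j
    have a2 := hs j
    refine (natDegree_mul_le_of_le (m := p * j) (n := 3 * M + B + 3 * h) (by simp) ?_).trans
      (by omega)
    apply natDegree_add_le_of_degree_le
    · refine (natDegree_mul_le_of_le (m := M * 3) (n := B - 1) ?_ a1).trans (by omega)
      rw [natDegree_pow, hf]
    · refine (natDegree_mul_le_of_le (m := (M + h) * 3) (n := B - 1) ?_ a2).trans (by omega)
      rw [natDegree_pow, hf]
  calc M * S.card = ∑ x ∈ S, M := by simp [mul_comm]
    _ ≤ ∑ x ∈ S, F.roots.count x := Finset.sum_le_sum fun x hx => by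
        rw [count_roots]; exact hmult x hx
    _ ≤ Multiset.card F.roots := by
        have hsub : S ⊆ F.roots.toFinset := fun x hx => by
          rw [Multiset.mem_toFinset, mem_roots hF0]
          exact hder 0 (by omega) x hx
        rw [← Multiset.toFinset_sum_count_eq]
        exact Finset.sum_le_sum_of_subset hsub
    _ ≤ F.natDegree := card_roots' F
    _ ≤ _ := hdegF

lemma cubic_sum0 {p : ℕ} [Fact p.Prime] (hp : 100 ≤ p) (f : (ZMod p)[X]) (hf : f.natDegree = 3)
    (h0 : f.coeff 0 ≠ 0) :
    (∑ x : ZMod p, quadraticChar (ZMod p) (f.eval x)) ^ 2 ≤ 576 * (p : ℤ) := by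
  classical
  have hpr : p.Prime := Fact.out
  have h2 : p ≠ 2 := by omega
  have hodd := hpr.eq_two_or_odd.resolve_left h2
  have hfne : f ≠ 0 := by rintro rfl; simp at hf
  have hchar : ringChar (ZMod p) ≠ 2 := by rw [ZMod.ringChar_zmod_n]; exact h2
  obtain ⟨h, hh⟩ : ∃ h, h = Nat.sqrt p / 2 := ⟨_, rfl⟩
  have hs1 : Nat.sqrt p * Nat.sqrt p ≤ p := Nat.sqrt_le p
  have hs2 : p < (Nat.sqrt p + 1) * (Nat.sqrt p + 1) := Nat.lt_succ_sqrt p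
  have hs3 : 10 ≤ Nat.sqrt p := by
    rw [Nat.le_sqrt]; omega
  generalize Nat.sqrt p = q at *
  have hq1 : 2 * h ≤ q := by omega
  have hq2 : q ≤ 2 * h + 1 := by omega
  have hh5 : 5 ≤ h := by omega
  have k1 : 4 * (h * h) ≤ p := by nlinarith
  have k2 : p ≤ 16 * (h * h) := by nlinarith
  have key : ∀ (e : ZMod p) (S : Finset (ZMod p)),
      (∀ x ∈ S, (f.eval x) ^ ((p - 1) / 2) = e) → 2 * h * S.card ≤ 6 * h + 5 * p + p * h := by
    intro e S hS
    have hB : 2 * ((p - 3) / 2) + 3 = p := by omega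
    have hb2 : 2 * ((p - 1) / 2) + 1 = p := by omega
    have := st_count h2 f hf h0 e ((p - 3) / 2) (2 * h) (h + 4) (by omega) (by omega) (by omega)
      (by nlinarith) (by nlinarith) S hS
    have e1 : p * (h + 4 - 1) = p * h + 3 * p := by
      rw [show h + 4 - 1 = h + 3 by omega]; ring
    rw [e1] at this
    omega
  set χ := quadraticChar (ZMod p) with hχ
  let S1 := Finset.univ.filter fun x => χ (f.eval x) = 1
  let S2 := Finset.univ.filter fun x => χ (f.eval x) = -1
  let S0 := Finset.univ.filter fun x => χ (f.eval x) = 0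
  have hpow : ∀ x, ((χ x : ℤ) : ZMod p) = x ^ ((p - 1) / 2) := by
    intro x
    have := quadraticChar_eq_pow_of_char_ne_two' hchar x
    rw [ZMod.card] at this
    rw [hχ, this]; congr 1; omega
  have c1 := key 1 S1 (fun x hx => by
    rw [← hpow, (Finset.mem_filter.mp hx).2]; simp)
  have c2 := key (-1) S2 (fun x hx => by
    rw [← hpow, (Finset.mem_filter.mp hx).2]; simp)
  have c0 : S0.card ≤ 3 := by
    rw [← hf]
    apply card_le_degree_of_subset_roots
    intro x hx
    have := (Finset.mem_filter.mp hx).2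
    rw [mem_roots hfne, IsRoot]
    exact quadraticChar_eq_zero_iff.mp this
  have trich : ∀ x, χ x = 0 ∨ χ x = 1 ∨ χ x = -1 := by
    intro x
    by_cases hx : x = 0
    · left; rw [hx]; exact quadraticChar_zero
    · right; exact quadraticChar_dichotomy hx
  have sumA : ∑ x : ZMod p, χ (f.eval x) = (S1.card : ℤ) - S2.card := by
    simp only [S1, S2, Finset.card_filter, Nat.cast_sum, ← Finset.sum_sub_distrib]
    refine Finset.sum_congr rfl fun x _ => ?_
    rcases trich (f.eval x) with h | h | h <;> simp [h]
  have sumB : (p : ℤ) = (S1.card : ℤ) + S2.card + S0.card := by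
    simp only [S1, S2, S0, Finset.card_filter, Nat.cast_sum, ← Finset.sum_add_distrib]
    have : (p : ℤ) = ∑ x : ZMod p, 1 := by simp [ZMod.card]
    rw [this]
    refine Finset.sum_congr rfl fun x _ => ?_
    rcases trich (f.eval x) with h | h | h <;> simp [h]
  rw [sumA]
  generalize S1.card = n1 at *
  generalize S2.card = n2 at *
  generalize S0.card = n0 at *
  zify at c1 c2 c0 k1 k2 hh5
  have u1 : (h : ℤ) * (n1 - n2) ≤ 6 * p := by
    have : (p : ℤ) * h = (n1 + n2 + n0) * h := by rw [← sumB]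
    nlinarith
  have u2 : -(6 * (p : ℤ)) ≤ h * (n1 - n2) := by
    have : (p : ℤ) * h = (n1 + n2 + n0) * h := by rw [← sumB]
    nlinarith
  have u3 : ((h : ℤ) * (n1 - n2)) ^ 2 ≤ (6 * p) ^ 2 := sq_le_sq' u2 u1
  have u4 : ((h : ℤ) * h) * (n1 - n2 : ℤ) ^ 2 ≤ (h * h) * (576 * p) := by
    have : (p : ℤ) * p ≤ (16 * (h * h)) * p := mul_le_mul_of_nonneg_right k2 (by positivity)
    nlinarith
  exact le_of_mul_le_mul_left u4 (by positivity)

lemma cubic_sum {p : ℕ} [Fact p.Prime] (hp : 100 ≤ p) (k m : ZMod p) :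
    (∑ x : ZMod p, quadraticChar (ZMod p) ((x - k) * (x ^ 2 + m))) ^ 2 ≤ 576 * (p : ℤ) := by
  classical
  let f : (ZMod p)[X] := (X - C k) * (X ^ 2 + C m)
  have hd2 : (X ^ 2 + C m : (ZMod p)[X]).natDegree = 2 := natDegree_X_pow_add_C
  have hne2 : (X ^ 2 + C m : (ZMod p)[X]) ≠ 0 := by intro h; rw [h] at hd2; simp at hd2
  have hf : f.natDegree = 3 := by
    rw [natDegree_mul (X_sub_C_ne_zero k) hne2, hd2, natDegree_X_sub_C]
  have hfne : f ≠ 0 := by intro h; rw [h] at hf; simp at hf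
  obtain ⟨x0, hx0⟩ : ∃ x0, f.eval x0 ≠ 0 := by
    by_contra hcon
    push Not at hcon
    have := card_le_degree_of_subset_roots (p := f) (Z := Finset.univ) (fun x _ => by
      rw [mem_roots hfne]; exact hcon x)
    rw [Finset.card_univ, ZMod.card] at this
    omega
  have := cubic_sum0 hp (f.comp (X + C x0)) (by rw [natDegree_comp, hf]; simp) (by
    rw [coeff_zero_eq_eval_zero, eval_comp]; simpa using hx0)
  convert this using 2
  rw [← Equiv.sum_comp (Equiv.addRight x0)]
  refine Finset.sum_congr rfl fun x _ => ?_
  simp [f]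

lemma ch_sq {p : ℕ} [Fact p.Prime] {x y : ZMod p} (a : ZMod p) (ha : a ≠ 0) (h : x = a ^ 2 * y) :
    quadraticChar (ZMod p) x = quadraticChar (ZMod p) y := by
  rw [h, map_mul, quadraticChar_sq_one' ha, one_mul]

lemma ch_abs {p : ℕ} [Fact p.Prime] (x : ZMod p) : |quadraticChar (ZMod p) x| ≤ 1 := by
  by_cases hx : x = 0
  · rw [hx, quadraticChar_zero]; simp
  · rcases quadraticChar_dichotomy hx with h | h <;> rw [h] <;> simp

lemma sum_abs {p : ℕ} [Fact p.Prime] (g : ZMod p → ZMod p) :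
    |∑ x, quadraticChar (ZMod p) (g x)| ≤ (p : ℤ) := by
  refine (Finset.abs_sum_le_sum_abs _ _).trans ?_
  refine (Finset.sum_le_sum fun x _ => ch_abs (g x)).trans ?_
  simp [ZMod.card]

lemma sum_aff {p : ℕ} [Fact p.Prime] (f : ZMod p → ℤ) (a b : ZMod p) (ha : a ≠ 0) :
    ∑ x, f (a * x + b) = ∑ x, f x :=
  Equiv.sum_comp ((Equiv.mulLeft₀ a ha).trans (Equiv.addRight b)) f

lemma ch_char {p : ℕ} [Fact p.Prime] (h2 : p ≠ 2) : ringChar (ZMod p) ≠ 2 := by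
  rw [ZMod.ringChar_zmod_n]; exact h2

lemma two_ne {p : ℕ} [Fact p.Prime] (h2 : p ≠ 2) : (2 : ZMod p) ≠ 0 :=
  Ring.two_ne_zero (ch_char h2)

lemma sum_ch {p : ℕ} [Fact p.Prime] (h2 : p ≠ 2) (b : ZMod p) :
    ∑ x, quadraticChar (ZMod p) (x + b) = 0 := by
  have := sum_aff (fun x => quadraticChar (ZMod p) x) 1 b one_ne_zero
  simp only [one_mul] at this
  rw [this, quadraticChar_sum_zero (ch_char h2)]

lemma sum_sq {p : ℕ} [Fact p.Prime] (h2 : p ≠ 2) (g : ZMod p → ℤ) :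
    ∑ x, g (x ^ 2) = ∑ u, (1 + quadraticChar (ZMod p) u) * g u := by
  classical
  rw [← Finset.sum_fiberwise (s := Finset.univ) (g := fun x : ZMod p => x ^ 2)]
  refine Finset.sum_congr rfl fun u _ => ?_
  have := quadraticChar_card_sqrts (ch_char h2) u
  rw [add_comm 1, ← this]
  rw [Finset.sum_congr rfl (g := fun _ => g u) (fun x hx => by rw [(Finset.mem_filter.mp hx).2])]
  rw [Finset.sum_const, nsmul_eq_mul]
  congr 3
  ext x; simp

lemma sum_q0 {p : ℕ} [Fact p.Prime] (h2 : p ≠ 2) (d : ZMod p) (hd : d ≠ 0) :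
    ∑ u, quadraticChar (ZMod p) (u * (u + d)) = -1 := by
  classical
  have e1 : ∀ u : ZMod p, quadraticChar (ZMod p) (u * (u + d))
      = quadraticChar (ZMod p) (d * u⁻¹ + 1) - if u = 0 then 1 else 0 := by
    intro u
    by_cases hu : u = 0
    · simp [hu]
    · rw [if_neg hu, sub_zero]
      apply ch_sq u hu
      field_simp
      ring
  rw [Finset.sum_congr rfl fun u _ => e1 u, Finset.sum_sub_distrib]
  have e2 : ∑ u : ZMod p, quadraticChar (ZMod p) (d * u⁻¹ + 1) = 0 := by
    have := Equiv.sum_comp (Equiv.inv (ZMod p)) (fun u => quadraticChar (ZMod p) (d * u + 1))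
    simp only [Equiv.inv_apply] at this
    rw [this, sum_aff (fun u => quadraticChar (ZMod p) u) d 1 hd, quadraticChar_sum_zero (ch_char h2)]
  rw [e2]; simp

lemma sum_q {p : ℕ} [Fact p.Prime] (h2 : p ≠ 2) (a u d : ZMod p) :
    ∑ s, quadraticChar (ZMod p) (a * ((s + u) ^ 2 + d))
      = quadraticChar (ZMod p) a * ((if d = 0 then (p : ℤ) else 0) - 1) := by
  classical
  simp only [map_mul, ← Finset.mul_sum]
  congr 1
  have := sum_aff (fun s => quadraticChar (ZMod p) (s ^ 2 + d)) 1 u one_ne_zero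
  simp only [one_mul] at this
  rw [this]
  split_ifs with h
  · subst h
    have e1 : ∀ u : ZMod p, quadraticChar (ZMod p) (u ^ 2 + 0) = 1 - if u = 0 then 1 else 0 := by
      intro u
      by_cases hu : u = 0
      · simp [hu]
      · rw [add_zero, quadraticChar_sq_one' hu, if_neg hu, sub_zero]
    rw [Finset.sum_congr rfl fun u _ => e1 u, Finset.sum_sub_distrib]
    simp [ZMod.card]
  · rw [sum_sq h2 (fun u => quadraticChar (ZMod p) (u + d))]
    simp only [add_mul, one_mul, Finset.sum_add_distrib, sum_ch h2, ← map_mul]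
    rw [sum_q0 h2 d h]; simp

lemma sum_sym {p : ℕ} [Fact p.Prime] (h2 : p ≠ 2) (g : ZMod p → ZMod p → ℤ) :
    ∑ x, ∑ y, g (x + y) (x * y)
      = ∑ s, ∑ t, (1 + quadraticChar (ZMod p) (s ^ 2 - 4 * t)) * g s t := by
  have h20 := two_ne h2
  have e1 : ∀ x : ZMod p, ∑ y, g (x + y) (x * y) = ∑ s, g s (x * (s - x)) := by
    intro x
    rw [← sum_aff (fun s => g s (x * (s - x))) 1 x one_ne_zero]
    refine Finset.sum_congr rfl fun y _ => ?_
    congr 1 <;> ring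
  rw [Finset.sum_congr rfl fun x _ => e1 x, Finset.sum_comm]
  refine Finset.sum_congr rfl fun s _ => ?_
  rw [← sum_aff (fun x => g s (x * (s - x))) 1 (s / 2) one_ne_zero]
  have e2 : ∀ z : ZMod p, g s ((1 * z + s / 2) * (s - (1 * z + s / 2)))
      = (fun u => g s (s ^ 2 / 4 - u)) (z ^ 2) := by
    intro z
    simp only
    congr 1
    have : (4 : ZMod p) = 2 * 2 := by norm_num
    rw [this]
    field_simp
    ring
  rw [Finset.sum_congr rfl fun x _ => e2 x]
  refine (sum_sq h2 (fun u => g s (s ^ 2 / 4 - u))).trans ?_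
  rw [← sum_aff (fun u => (1 + quadraticChar (ZMod p) u) * g s (s ^ 2 / 4 - u)) (-1) (s ^ 2 / 4)
    (by simp)]
  refine Finset.sum_congr rfl fun t _ => ?_
  have h4 : (4 : ZMod p) = 2 * 2 := by norm_num
  congr 2
  · symm
    apply ch_sq 2 h20
    rw [h4]; field_simp
    ring
  · ring

noncomputable def GG {p : ℕ} [Fact p.Prime] (d : ZMod p) : ℤ :=
  ∑ x, quadraticChar (ZMod p) (x * (x + 1) * (x + d))

lemma isog {p : ℕ} [Fact p.Prime] (h2 : p ≠ 2) (d : ZMod p) (hd : d ≠ 0) :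
    ∑ v, quadraticChar (ZMod p) ((v ^ 2 - d) * (d + 1 + 2 * v)) = GG d := by
  classical
  have h20 := two_ne h2
  have h := sum_sym h2 (fun s t => if t = d then quadraticChar (ZMod p) (s + (d + 1)) else 0)
  have e1 : ∀ x : ZMod p, (∑ y, if x * y = d then quadraticChar (ZMod p) (x + y + (d + 1)) else 0)
      = quadraticChar (ZMod p) (x * (x + 1) * (x + d)) := by
    intro x
    by_cases hx : x = 0
    · subst hx
      simp [hd.symm]
    · rw [Finset.sum_eq_single (d / x)]
      · rw [if_pos (by field_simp)]
        symm
        apply ch_sq x hx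
        field_simp
        ring
      · intro y _ hy
        rw [if_neg]
        rintro rfl
        apply hy; field_simp
      · simp
  rw [Finset.sum_congr rfl fun x _ => e1 x] at h
  rw [GG, h]
  simp only [mul_ite, mul_zero, Finset.sum_ite_eq', Finset.mem_univ, if_true, add_mul, one_mul,
    Finset.sum_add_distrib, sum_ch h2, zero_add, ← map_mul]
  rw [← sum_aff (fun v => quadraticChar (ZMod p) ((v ^ 2 - 4 * d) * (v + (d + 1)))) 2 0 h20]
  refine Finset.sum_congr rfl fun v _ => ?_
  symm
  apply ch_sq 2 h20
  ring

lemma GG_abs {p : ℕ} [Fact p.Prime] (d : ZMod p) : |GG d| ≤ (p : ℤ) := sum_abs _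

lemma sum_GG {p : ℕ} [Fact p.Prime] (h2 : p ≠ 2) :
    ∑ d, quadraticChar (ZMod p) d * GG (p := p) d = 1 := by
  classical
  simp only [GG, Finset.mul_sum]
  rw [Finset.sum_comm]
  have e1 : ∀ x : ZMod p, ∑ d, quadraticChar (ZMod p) d * quadraticChar (ZMod p)
      (x * (x + 1) * (x + d)) = - quadraticChar (ZMod p) (x * (x + 1)) := by
    intro x
    by_cases hx : x = 0
    · simp [hx]
    · have := sum_q0 h2 x hx
      rw [← mul_neg_one, ← this, Finset.mul_sum]
      refine Finset.sum_congr rfl fun d _ => ?_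
      rw [← map_mul, ← map_mul]; congr 1; ring
  rw [Finset.sum_congr rfl fun x _ => e1 x, Finset.sum_neg_distrib, sum_q0 h2 1 one_ne_zero]
  simp

noncomputable def SS {p : ℕ} [Fact p.Prime] (l : ZMod p) : ℤ :=
  ∑ c, ∑ b, quadraticChar (ZMod p) ((c ^ 2 - c) * (b - l * c) * (b - 1) * b)

lemma SS_eq {p : ℕ} [Fact p.Prime] (l : ZMod p) :
    SS l = quadraticChar (ZMod p) (-1) * ∑ r, quadraticChar (ZMod p) (r * (r - l)) * GG r := by
  classical
  simp only [GG, Finset.mul_sum, ← map_mul]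
  rw [Finset.sum_comm, SS]
  rw [← Equiv.sum_comp ((Equiv.inv (ZMod p)).trans (Equiv.neg (ZMod p)))]
  refine Finset.sum_congr rfl fun x _ => ?_
  simp only [Equiv.trans_apply, Equiv.inv_apply, Equiv.neg_apply]
  by_cases hx : x = 0
  · simp [hx]
  · rw [← sum_aff _ (-x⁻¹) 0 (by simpa using hx)]
    refine Finset.sum_congr rfl fun r _ => ?_
    apply ch_sq (x⁻¹ ^ 3) (by simpa using hx)
    field_simp
    ring

lemma A_sq {p : ℕ} [Fact p.Prime] (h2 : p ≠ 2) (k m : ZMod p) (hm : m ≠ 0)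
    (hN : k ^ 2 + m ≠ 0) :
    (∑ x : ZMod p, quadraticChar (ZMod p) ((x - k) * (x ^ 2 + m))) ^ 2
      = p + ∑ s, ∑ t, quadraticChar (ZMod p)
        ((s ^ 2 - 4 * t) * ((t - k * s + k ^ 2) * ((t - m) ^ 2 + m * s ^ 2))) := by
  classical
  have h := sum_sym h2 (fun s t => quadraticChar (ZMod p)
    ((t - k * s + k ^ 2) * ((t - m) ^ 2 + m * s ^ 2)))
  have e1 : (∑ x : ZMod p, quadraticChar (ZMod p) ((x - k) * (x ^ 2 + m))) ^ 2
      = ∑ x, ∑ y, quadraticChar (ZMod p) ((x * y - k * (x + y) + k ^ 2) *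
        ((x * y - m) ^ 2 + m * (x + y) ^ 2)) := by
    rw [sq, Finset.sum_mul_sum]
    refine Finset.sum_congr rfl fun x _ => Finset.sum_congr rfl fun y _ => ?_
    rw [← map_mul]; congr 1; ring
  rw [e1, h]
  simp only [one_add_mul, Finset.sum_add_distrib, ← map_mul]
  congr 1
  rw [Finset.sum_congr rfl fun s _ => (sum_aff (fun t => quadraticChar (ZMod p)
    ((t - k * s + k ^ 2) * ((t - m) ^ 2 + m * s ^ 2))) 1 (m + k * s) one_ne_zero).symm]
  rw [Finset.sum_comm]
  have e2 : ∀ l : ZMod p, ∑ s, quadraticChar (ZMod p)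
      ((1 * l + (m + k * s) - k * s + k ^ 2) * ((1 * l + (m + k * s) - m) ^ 2 + m * s ^ 2))
      = (if l = 0 then (p : ℤ) else 0) - quadraticChar (ZMod p) (k ^ 2 + m) *
        quadraticChar (ZMod p) (l + (k ^ 2 + m)) := by
    intro l
    have e3 : ∀ s : ZMod p, quadraticChar (ZMod p)
      ((1 * l + (m + k * s) - k * s + k ^ 2) * ((1 * l + (m + k * s) - m) ^ 2 + m * s ^ 2))
      = quadraticChar (ZMod p) (l + (k ^ 2 + m)) * quadraticChar (ZMod p) ((k ^ 2 + m) *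
        ((s + k * l / (k ^ 2 + m)) ^ 2 + m * l ^ 2 / (k ^ 2 + m) ^ 2)) := by
      intro s
      rw [← map_mul]; congr 1
      field_simp
      ring
    rw [Finset.sum_congr rfl fun s _ => e3 s, ← Finset.mul_sum, sum_q h2]
    by_cases hl : l = 0
    · subst hl
      have := quadraticChar_sq_one hN
      simp only [zero_add, ne_eq, OfNat.ofNat_ne_zero, not_false_eq_true, zero_pow, mul_zero,
        zero_div, if_true]
      linear_combination ((p : ℤ)) * this
    · rw [if_neg hl, if_neg (by
        simp only [div_eq_zero_iff, mul_eq_zero, pow_eq_zero_iff, ne_eq, OfNat.ofNat_ne_zero,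
          not_false_eq_true]
        tauto)]
      ring
  rw [Finset.sum_congr rfl fun l _ => e2 l, Finset.sum_sub_distrib, ← Finset.mul_sum, sum_ch h2]
  simp

lemma T_T1 {p : ℕ} [Fact p.Prime] (k m : ZMod p) :
    |∑ s, ∑ t, quadraticChar (ZMod p)
        ((s ^ 2 - 4 * t) * ((t - k * s + k ^ 2) * ((t - m) ^ 2 + m * s ^ 2)))
      - ∑ z, ∑ s, quadraticChar (ZMod p)
        ((z ^ 2 + m) * (s ^ 2 - 4 * z * s - 4 * m) * (k ^ 2 + m + (z - k) * s))| ≤ 2 * (p : ℤ) := by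
  classical
  rw [Finset.sum_comm (f := fun z s => quadraticChar (ZMod p)
        ((z ^ 2 + m) * (s ^ 2 - 4 * z * s - 4 * m) * (k ^ 2 + m + (z - k) * s)))]
  rw [← Finset.sum_sub_distrib, Finset.sum_eq_single 0]
  · refine (abs_sub _ _).trans ?_
    have a1 := sum_abs (fun t : ZMod p =>
      (((0:ZMod p) ^ 2 - 4 * t) * ((t - k * 0 + k ^ 2) * ((t - m) ^ 2 + m * 0 ^ 2))))
    have a2 := sum_abs (fun z : ZMod p =>
      ((z ^ 2 + m) * ((0:ZMod p) ^ 2 - 4 * z * 0 - 4 * m) * (k ^ 2 + m + (z - k) * 0)))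
    linarith
  · intro s _ hs
    rw [sub_eq_zero, ← sum_aff _ s m hs]
    refine Finset.sum_congr rfl fun z _ => ?_
    apply ch_sq s hs
    ring
  · simp

lemma T1_T2 {p : ℕ} [Fact p.Prime] (h2 : p ≠ 2) (k m : ZMod p) :
    |∑ z, ∑ s, quadraticChar (ZMod p)
        ((z ^ 2 + m) * (s ^ 2 - 4 * z * s - 4 * m) * (k ^ 2 + m + (z - k) * s))
      - ∑ z, quadraticChar (ZMod p) ((z ^ 2 + m) / (z - k) ^ 2) * GG ((z ^ 2 + m) / (z - k) ^ 2)|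
      ≤ (p : ℤ) := by
  classical
  have h20 := two_ne h2
  rw [← Finset.sum_sub_distrib, Finset.sum_eq_single k]
  · simp only [sub_self]
    rw [show (k ^ 2 + m) / (0 : ZMod p) ^ 2 = 0 by simp, quadraticChar_zero, zero_mul, sub_zero]
    exact sum_abs _
  · intro z _ hz
    have he : z - k ≠ 0 := sub_ne_zero.mpr hz
    obtain ⟨d, hd⟩ : ∃ d, d = (z ^ 2 + m) / (z - k) ^ 2 := ⟨_, rfl⟩
    rw [← hd]
    have hD : z ^ 2 + m = d * (z - k) ^ 2 := by rw [hd]; field_simp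
    by_cases hd0 : d = 0
    · rw [hD, hd0]; simp
    · rw [← isog h2 d hd0, sub_eq_zero, Finset.mul_sum, ← sum_aff _ (2 * (z - k)) (2 * z)
        (mul_ne_zero h20 he)]
      refine Finset.sum_congr rfl fun v _ => ?_
      rw [← map_mul]
      apply ch_sq (2 * (z - k) ^ 3) (mul_ne_zero h20 (pow_ne_zero _ he))
      have hm : m = d * (z - k) ^ 2 - z ^ 2 := by rw [← hD]; ring
      rw [hm]
      ring
  · simp

lemma T2_eq {p : ℕ} [Fact p.Prime] (h2 : p ≠ 2) (k m l : ZMod p) (hN : k ^ 2 + m ≠ 0)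
    (hl : (k ^ 2 + m) * l = m) :
    ∑ z, quadraticChar (ZMod p) ((z ^ 2 + m) / (z - k) ^ 2) * GG ((z ^ 2 + m) / (z - k) ^ 2)
      = 1 + quadraticChar (ZMod p) (-(k ^ 2 + m)) * SS l - GG (p := p) 1 := by
  classical
  obtain ⟨H, hH⟩ : ∃ H : ZMod p → ℤ, H = fun d => quadraticChar (ZMod p) d * GG d := ⟨_, rfl⟩
  have hH0 : H 0 = 0 := by rw [hH]; simp
  have hH1 : H 1 = GG (p := p) 1 := by rw [hH]; simp
  have s1 : ∑ z, quadraticChar (ZMod p) ((z ^ 2 + m) / (z - k) ^ 2) *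
      GG ((z ^ 2 + m) / (z - k) ^ 2) = ∑ z, H ((z ^ 2 + m) / (z - k) ^ 2) := by rw [hH]
  have s2 : ∑ z, H ((z ^ 2 + m) / (z - k) ^ 2)
      = ∑ u, H ((k ^ 2 + m) * u ^ 2 + 2 * k * u + 1) - H 1 := by
    rw [← sum_aff (fun z => H ((z ^ 2 + m) / (z - k) ^ 2)) 1 k one_ne_zero]
    rw [← Equiv.sum_comp (Equiv.inv (ZMod p))]
    have : H 1 = ∑ u : ZMod p, if u = 0 then H 1 else 0 := by simp
    rw [this, ← Finset.sum_sub_distrib]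
    refine Finset.sum_congr rfl fun u _ => ?_
    simp only [Equiv.inv_apply]
    by_cases hu : u = 0
    · subst hu; simp [hH0]
    · rw [if_neg hu, sub_zero]; congr 1
      field_simp
      ring
  have s3 : ∑ u, H ((k ^ 2 + m) * u ^ 2 + 2 * k * u + 1)
      = ∑ v, H ((k ^ 2 + m) * v ^ 2 + l) := by
    rw [← sum_aff (fun v => H ((k ^ 2 + m) * v ^ 2 + l)) 1 (k / (k ^ 2 + m)) one_ne_zero]
    refine Finset.sum_congr rfl fun u _ => ?_
    congr 1
    have : l = m / (k ^ 2 + m) := by rw [eq_div_iff hN, mul_comm]; exact hl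
    rw [this]
    field_simp
    ring
  have s4 : ∑ v, H ((k ^ 2 + m) * v ^ 2 + l)
      = ∑ d, (1 + quadraticChar (ZMod p) ((k ^ 2 + m) * (d - l))) * H d := by
    refine (sum_sq h2 (fun u => H ((k ^ 2 + m) * u + l))).trans ?_
    rw [← sum_aff (fun d => (1 + quadraticChar (ZMod p) ((k ^ 2 + m) * (d - l))) * H d)
      (k ^ 2 + m) l hN]
    refine Finset.sum_congr rfl fun u _ => ?_
    congr 2
    symm
    apply ch_sq (k ^ 2 + m) hN
    ring
  rw [s1, s2, s3, s4, hH1, SS_eq]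
  simp only [add_mul, one_mul, Finset.sum_add_distrib]
  have s5 : ∑ d, H d = 1 := by rw [hH]; exact sum_GG h2
  rw [s5, ← mul_assoc, ← map_mul, Finset.mul_sum]
  congr 2
  refine Finset.sum_congr rfl fun d _ => ?_
  rw [hH]
  simp only [← mul_assoc, ← map_mul]
  congr 2
  ring

lemma SS_bound1 {p : ℕ} [Fact p.Prime] (hp : 100 ≤ p) (k m l : ZMod p) (hm : m ≠ 0)
    (hN : k ^ 2 + m ≠ 0) (hl : (k ^ 2 + m) * l = m) : |SS l| ≤ 600 * (p : ℤ) := by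
  have h2 : p ≠ 2 := by omega
  have a0 := cubic_sum hp k m
  have a1 := A_sq h2 k m hm hN
  have a2 := T_T1 k m
  have a3 := T1_T2 h2 k m
  have a4 := T2_eq h2 k m l hN hl
  have a5 := GG_abs (p := p) 1
  have a6 := sq_nonneg (∑ x : ZMod p, quadraticChar (ZMod p) ((x - k) * (x ^ 2 + m)))
  have a7 : |SS l| = |quadraticChar (ZMod p) (-(k ^ 2 + m)) * SS l| := by
    rw [abs_mul]
    rcases quadraticChar_dichotomy (neg_ne_zero.mpr hN) with h | h <;> rw [h] <;> simp
  rw [a7]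
  rw [a1] at a0 a6
  rw [a4] at a3
  rw [abs_le] at *
  have : (100 : ℤ) ≤ p := by exact_mod_cast hp
  constructor <;> linarith

lemma SS_bound {p : ℕ} [Fact p.Prime] (l : ZMod p) (hl : l ≠ 0) : |SS l| ≤ 600 * (p : ℤ) := by
  by_cases hp : 100 ≤ p
  · by_cases h1 : l = 1
    · exact SS_bound1 hp 0 1 l one_ne_zero (by simp) (by simp [h1])
    · have h1' : 1 - l ≠ 0 := sub_ne_zero.mpr (Ne.symm h1)
      have e : (1 : ZMod p) ^ 2 + l / (1 - l) = 1 / (1 - l) := by field_simp; ring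
      refine SS_bound1 hp 1 (l / (1 - l)) l (div_ne_zero hl h1') ?_ ?_
      · rw [e]; exact div_ne_zero one_ne_zero h1'
      · rw [e]; ring
  · have : |SS l| ≤ ∑ c : ZMod p, (p : ℤ) :=
      (Finset.abs_sum_le_sum_abs _ _).trans (Finset.sum_le_sum fun c _ => sum_abs _)
    refine this.trans ?_
    simp only [Finset.sum_const, Finset.card_univ, ZMod.card, nsmul_eq_mul]
    have : (p : ℤ) ≤ 100 := by exact_mod_cast (by omega)
    nlinarith [Int.natCast_nonneg p]

lemma sum_Icc {p : ℕ} [Fact p.Prime] (g : ZMod p → ℤ) (h0 : g 0 = 0) :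
    ∑ c ∈ Finset.Icc 1 (p - 1), g (c : ZMod p) = ∑ x, g x := by
  have hp : p.Prime := Fact.out
  have hp1 := hp.one_lt
  have e1 : ∑ x, g x = ∑ x ∈ Finset.univ.filter (fun x : ZMod p => x ≠ 0), g x := by
    symm
    apply Finset.sum_subset (Finset.subset_univ _)
    intro x _ hx
    have : x = 0 := by simpa using hx
    rw [this, h0]
  rw [e1]
  refine Finset.sum_bij (fun c _ => (c : ZMod p)) ?_ ?_ ?_ ?_
  · intro c hc
    rw [Finset.mem_Icc] at hc
    simp only [Finset.mem_filter, Finset.mem_univ, true_and, Ne, ZMod.natCast_eq_zero_iff]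
    intro hd
    have := Nat.le_of_dvd (by omega) hd
    omega
  · intro c hc d hd h
    rw [Finset.mem_Icc] at hc hd
    rw [ZMod.natCast_eq_natCast_iff'] at h
    rwa [Nat.mod_eq_of_lt (by omega), Nat.mod_eq_of_lt (by omega)] at h
  · intro x hx
    have hx0 : x ≠ 0 := by simpa using hx
    refine ⟨x.val, ?_, by simp⟩
    rw [Finset.mem_Icc]
    have := ZMod.val_lt x
    have : x.val ≠ 0 := by rwa [Ne, ZMod.val_eq_zero]
    omega
  · intro c _; rfl

lemma final_eq {p : ℕ} [Fact p.Prime] (a : ZMod p) :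
    ∑ c ∈ Finset.Icc 1 (p - 1),
        legendreSym p ((c : ℤ) ^ 2 - (c : ℤ)) *
          phiFun p ((a.val : ℤ) ^ 2 * (c : ℤ)) = SS (a ^ 2) := by
  rw [SS, ← sum_Icc _ (by simp)]
  refine Finset.sum_congr rfl fun c _ => ?_
  rw [phiFun, ← sum_Icc _ (by simp), Finset.mul_sum]
  refine Finset.sum_congr rfl fun b _ => ?_
  simp only [legendreSym, ← map_mul]
  congr 1
  push_cast
  rw [ZMod.natCast_zmod_val]
  ring

end

/-- For every odd prime `p` and `a ∈ F_p`, `a ≠ 0`, one has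
`|Σ_{c=1}^{p-1} ((c²−c)/p)·φ(a²c)| ≤ K·p` with an absolute constant `K`. -/
theorem statement_15 : ∃ K : ℝ, 0 < K ∧ ∀ (p : ℕ) [Fact p.Prime], p ≠ 2 →
    ∀ a : ZMod p, a ≠ 0 →
    |((∑ c ∈ Finset.Icc 1 (p - 1),
        legendreSym p ((c : ℤ) ^ 2 - (c : ℤ)) *
          phiFun p ((a.val : ℤ) ^ 2 * (c : ℤ)) : ℤ) : ℝ)|
      ≤ K * (p : ℝ) := by
  refine ⟨600, by norm_num, ?_⟩
  intro p _ _ a ha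
  rw [final_eq]
  have := SS_bound (a ^ 2) (pow_ne_zero 2 ha)
  exact_mod_cast this
end
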